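/- Fix t ∈ (0,1/4) and set k = 4t. For every α ∈ (π/2)ℤ, the sum defining F^{(α)}(t) converges and F^{(α)}(t) = (2π/K(k)) · Σ_{n=1}^∞ ((1−q_k^{n})²/(1−q_k^{4n})) · q_k^{n(2|α|/π + 1)}. -/

import Mathlib

open Complex Real Set

noncomputable section

/-- A lattice point `(x,y)` viewed as the complex number `x + iy`. -/
def ptC (p : ℤ × ℤ) : ℂ := (p.1 : ℂ) + (p.2 : ℂ) * Complex.I

/-- A diagonal step on `ℤ²`. -/
def IsDiagStep (a b : ℤ × ℤ) : Prop :=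
  b - a = (1, 1) ∨ b - a = (1, -1) ∨ b - a = (-1, -1) ∨ b - a = (-1, 1)

/-- A rectilinear step on `ℤ²`. -/
def IsRectStep (a b : ℤ × ℤ) : Prop :=
  b - a = (1, 0) ∨ b - a = (-1, 0) ∨ b - a = (0, 1) ∨ b - a = (0, -1)

/-- `w` encodes a simple diagonal walk `(w₀, …, w_n)` as a list of length `n+1`. -/
def IsWalkList (w : List (ℤ × ℤ)) : Prop := w ≠ [] ∧ w.Chain' IsDiagStep

/-- Winding angle of the walk `w` around the origin up to time `i`. -/
def windTo (w : List (ℤ × ℤ)) (i : ℕ) : ℝ :=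
  ∑ j ∈ Finset.range i, (ptC (w.getD (j + 1) 0) / ptC (w.getD j 0)).arg

/-- The full winding angle of the walk `w` around the origin. -/
def wind (w : List (ℤ × ℤ)) : ℝ := windTo w (w.length - 1)

/-- The condition on walks counted by `W^{(α,I)}_{l,p}`: a simple diagonal walk on
`ℤ² ∖ {0}` from `(p,0)` to a point on one of the axes at distance `l` from the origin,
with full winding angle `α` and intermediate winding angles in `I`. -/
def WCond (l p : ℕ) (α : ℝ) (I : Set ℝ) (w : List (ℤ × ℤ)) : Prop :=
  IsWalkList w ∧ (∀ x ∈ w, x ≠ (0, 0)) ∧ w.head? = some ((p : ℤ), 0) ∧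
    (w.getLast? = some ((l : ℤ), 0) ∨ w.getLast? = some (-(l : ℤ), 0) ∨
      w.getLast? = some (0, (l : ℤ)) ∨ w.getLast? = some (0, -(l : ℤ))) ∧
    wind w = α ∧ (∀ i, 1 ≤ i → i ≤ w.length - 2 → windTo w i ∈ I)

/-- The generating function `W^{(α,I)}_{l,p}(t)`. -/
def Wgen (t : ℝ) (l p : ℕ) (α : ℝ) (I : Set ℝ) : ℝ :=
  ∑' w : {w : List (ℤ × ℤ) // WCond l p α I w}, t ^ (w.val.length - 1)

/-- The complete elliptic integral of the first kind `K(k)`. -/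
def Kell (k : ℝ) : ℝ := ∫ y in (0:ℝ)..1, 1 / Real.sqrt ((1 - y ^ 2) * (1 - k ^ 2 * y ^ 2))

/-- The complete elliptic integral of the second kind `E(k)`. -/
def Eell (k : ℝ) : ℝ := ∫ y in (0:ℝ)..1, Real.sqrt (1 - k ^ 2 * y ^ 2) / Real.sqrt (1 - y ^ 2)

/-- The complementary modulus `k' = √(1-k²)`. -/
def kComp (k : ℝ) : ℝ := Real.sqrt (1 - k ^ 2)

/-- The elliptic nome `q_k = exp(-π K(k')/K(k))`. -/
def qNome (k : ℝ) : ℝ := Real.exp (-π * Kell (kComp k) / Kell k)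

/-- The descending Landen transformation `k₁ = (1-k')/(1+k')`. -/
def kLanden (k : ℝ) : ℝ := (1 - kComp k) / (1 + kComp k)

/-- `T_k = K(k')/(4K(k))`. -/
def Tell (k : ℝ) : ℝ := Kell (kComp k) / (4 * Kell k)

/-- The plane minus the two real slits `{z ∈ ℝ : z² ≥ κ}`. -/
def slitDom (κ : ℝ) : Set ℂ := {z : ℂ | ¬(z.im = 0 ∧ κ ≤ z.re ^ 2)}

/-- `v` is the analytic function `v_κ` on `ℂ ∖ {z ∈ ℝ : z² ≥ κ}` with `v 0 = 0` and
`v'(z) = 1/(4K(κ)√((κ-z²)(1-κz²)))`, the branch of the square root being positive on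
`(-√κ, √κ)` (by analytic continuation this determines `v` uniquely). -/
structure IsVmap (κ : ℝ) (v : ℂ → ℂ) : Prop where
  map_zero : v 0 = 0
  analytic : AnalyticOnNhd ℂ v (slitDom κ)
  deriv_real : ∀ x : ℝ, x ^ 2 < κ →
    HasDerivAt v ((1 / (4 * Kell κ * Real.sqrt ((κ - x ^ 2) * (1 - κ * x ^ 2))) : ℝ) : ℂ)
      (x : ℂ)

/-- The function `f_m(z) = cos(2πm(v(z) + 1/4)) - cos(πm/2)` built from `v = v_{k₁}`. -/
def fmFun (v : ℂ → ℂ) (m : ℕ) (z : ℂ) : ℂ :=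
  Complex.cos (2 * (π : ℂ) * m * (v z + 1 / 4)) - Complex.cos ((π : ℂ) * m / 2)

/-- `a n m` is the (real) Taylor coefficient `[zⁿ] f_m(z)` at `0`. -/
def IsCoeff (κ : ℝ) (v : ℂ → ℂ) (a : ℕ → ℕ → ℝ) : Prop :=
  ∀ m : ℕ, 1 ≤ m → ∀ z : ℂ, z ∈ slitDom κ → ‖z‖ < 1 →
    HasSum (fun n : ℕ => (a n m : ℂ) * z ^ n) (fmFun v m z)

/-- An excursion: a nonempty simple diagonal walk from the origin to the origin with no
intermediate visits to the origin. -/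
def IsExcursion (w : List (ℤ × ℤ)) : Prop :=
  2 ≤ w.length ∧ w.Chain' IsDiagStep ∧ w.head? = some (0, 0) ∧ w.getLast? = some (0, 0) ∧
    ∀ i, 1 ≤ i → i ≤ w.length - 2 → w.getD i 0 ≠ (0, 0)

/-- The winding angle sequence of an excursion: `θ₀ = θ₁ = 0`, increments of the first and
last step do not contribute, and `θ_n = θ_{n-1}`. -/
def windExcTo (w : List (ℤ × ℤ)) (i : ℕ) : ℝ :=
  ∑ j ∈ Finset.Icc 2 (min i (w.length - 2)), (ptC (w.getD j 0) / ptC (w.getD (j - 1) 0)).arg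

/-- The full winding angle of an excursion. -/
def windExc (w : List (ℤ × ℤ)) : ℝ := windExcTo w (w.length - 1)

/-- `F^{(α)}(t)`: generating function of excursions with winding angle `α`. -/
def Fgen (t α : ℝ) : ℝ :=
  ∑' w : {w : List (ℤ × ℤ) // IsExcursion w ∧ windExc w = α}, t ^ (w.val.length - 1)

/-- `F(t,b) = Σ_w t^{|w|} e^{i b θ^w}`, the characteristic function of excursions. -/
def Fchar (t b : ℝ) : ℂ :=
  ∑' w : {w : List (ℤ × ℤ) // IsExcursion w},
    (t : ℂ) ^ (w.val.length - 1) * Complex.exp (Complex.I * b * windExc w.val)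

/-- `ψ_k(z) = (1 - √(1-kz²))/(√k z)` (principal square root), `ψ_k(0) = 0`. -/
def psiK (k : ℝ) (z : ℂ) : ℂ :=
  if z = 0 then 0 else (1 - (1 - (k : ℂ) * z ^ 2) ^ ((1 : ℂ) / 2)) / ((Real.sqrt k : ℂ) * z)

/-- The theta series `∑ exp (-L n² + n z)` over the integers. -/
def thetaInt (L : ℝ) (z : ℂ) : ℂ := ∑' n : ℤ, Complex.exp (-L * n ^ 2 + n * z)

/-- The theta series `∑ exp (-L r² + r z)` over the half-integers. -/
def thetaHalf (L : ℝ) (z : ℂ) : ℂ :=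
  ∑' n : ℤ, Complex.exp (-L * (n + 1 / 2) ^ 2 + (n + 1 / 2) * z)

lemma exp_eq_jacobiTheta₂_term (L : ℝ) (z : ℂ) (n : ℤ) :
    Complex.exp (-L * n ^ 2 + n * z) = jacobiTheta₂_term n (z / (2 * π * I)) (I * L / π) := by
  have hπ : (π : ℂ) ≠ 0 := by exact_mod_cast Real.pi_ne_zero
  have hI : (2 * π * I : ℂ) ≠ 0 := by simp [hπ]
  rw [jacobiTheta₂_term]
  congr 1
  field_simp
  linear_combination (-(n:ℂ)^2 * L) * Complex.I_sq

lemma im_I_mul_div_pi_pos {L : ℝ} (hL : 0 < L) : 0 < (I * L / π : ℂ).im := by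
  have : (I * L / π : ℂ) = ((L / π : ℝ) : ℂ) * I := by push_cast; ring
  rw [this, Complex.mul_I_im, Complex.ofReal_re]
  positivity

lemma thetaInt_eq_jacobiTheta₂ (L : ℝ) (z : ℂ) :
    thetaInt L z = jacobiTheta₂ (z / (2 * π * I)) (I * L / π) := by
  simp only [thetaInt, jacobiTheta₂, exp_eq_jacobiTheta₂_term]

lemma hasSum_thetaInt {L : ℝ} (hL : 0 < L) (z : ℂ) :
    HasSum (fun n : ℤ => Complex.exp (-L * n ^ 2 + n * z)) (thetaInt L z) := by
  simp only [thetaInt_eq_jacobiTheta₂, exp_eq_jacobiTheta₂_term]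
  exact hasSum_jacobiTheta₂_term _ (im_I_mul_div_pi_pos hL)

lemma thetaHalf_term (L : ℝ) (z : ℂ) (n : ℤ) :
    Complex.exp (-L * (n + 1 / 2) ^ 2 + (n + 1 / 2) * z) =
      Complex.exp (-L / 4 + z / 2) * Complex.exp (-L * n ^ 2 + n * (z - L)) := by
  rw [← Complex.exp_add]
  congr 1
  ring

lemma thetaHalf_eq (L : ℝ) (z : ℂ) :
    thetaHalf L z = Complex.exp (-L / 4 + z / 2) * thetaInt L (z - L) := by
  simp only [thetaHalf, thetaInt, thetaHalf_term, tsum_mul_left]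

lemma hasSum_thetaHalf {L : ℝ} (hL : 0 < L) (z : ℂ) :
    HasSum (fun n : ℤ => Complex.exp (-L * (n + 1 / 2) ^ 2 + (n + 1 / 2) * z))
      (thetaHalf L z) := by
  simp only [thetaHalf_eq, thetaHalf_term]
  exact (hasSum_thetaInt hL _).mul_left _

lemma differentiable_thetaInt {L : ℝ} (hL : 0 < L) : Differentiable ℂ (thetaInt L) := by
  intro z
  rw [funext (thetaInt_eq_jacobiTheta₂ L)]
  exact (differentiableAt_jacobiTheta₂_fst _ (im_I_mul_div_pi_pos hL)).comp z (by fun_prop)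

lemma differentiable_thetaHalf {L : ℝ} (hL : 0 < L) : Differentiable ℂ (thetaHalf L) := by
  rw [funext (thetaHalf_eq L)]
  have := differentiable_thetaInt hL
  fun_prop

lemma thetaInt_add_two_pi_I (L : ℝ) (z : ℂ) : thetaInt L (z + 2 * π * I) = thetaInt L z := by
  have hI : (2 * π * I : ℂ) ≠ 0 := by simp [Real.pi_ne_zero]
  rw [thetaInt_eq_jacobiTheta₂, add_div, div_self hI, jacobiTheta₂_add_left,
    thetaInt_eq_jacobiTheta₂]

lemma thetaHalf_add_two_pi_I (L : ℝ) (z : ℂ) :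
    thetaHalf L (z + 2 * π * I) = -thetaHalf L z := by
  rw [thetaHalf_eq, thetaHalf_eq, add_sub_right_comm, thetaInt_add_two_pi_I,
    show -(L : ℂ) / 4 + (z + 2 * π * I) / 2 = (-L / 4 + z / 2) + π * I by ring,
    Complex.exp_add, Complex.exp_pi_mul_I]
  ring

lemma thetaInt_neg (L : ℝ) (z : ℂ) : thetaInt L (-z) = thetaInt L z := by
  rw [thetaInt_eq_jacobiTheta₂, neg_div, jacobiTheta₂_neg_left, thetaInt_eq_jacobiTheta₂]

lemma thetaInt_sub_two_mul (L : ℝ) (z : ℂ) :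
    thetaInt L (z - 2 * L) = Complex.exp (L - z) * thetaInt L z := by
  simp only [thetaInt, ← tsum_mul_left]
  conv_rhs => rw [← (Equiv.subRight (1 : ℤ)).tsum_eq]
  rw [← (Equiv.subRight (1 : ℤ)).tsum_eq, ← (Equiv.addRight (1 : ℤ)).tsum_eq]
  conv_rhs => rw [← (Equiv.addRight (2 : ℤ)).tsum_eq]
  refine tsum_congr fun n => ?_
  simp only [Equiv.coe_addRight, Equiv.subRight_apply, ← Complex.exp_add]
  congr 1
  push_cast
  ring

lemma thetaHalf_sub (L : ℝ) (z : ℂ) :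
    thetaHalf L (z - L) = Complex.exp (L / 4 - z / 2) * thetaInt L z := by
  rw [thetaHalf_eq, show z - (L : ℂ) - L = z - 2 * L by ring, thetaInt_sub_two_mul, ← mul_assoc,
    ← Complex.exp_add]
  congr 2
  ring

lemma thetaHalf_neg (L : ℝ) (z : ℂ) : thetaHalf L (-z) = thetaHalf L z := by
  have h := thetaHalf_sub L (L - z)
  rw [show (L : ℂ) - z - L = -z by ring] at h
  rw [h, thetaHalf_eq, ← thetaInt_neg L (z - L), neg_sub]
  congr 2
  ring

lemma conj_thetaInt (L : ℝ) (z : ℂ) :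
    (starRingEnd ℂ) (thetaInt L z) = thetaInt L ((starRingEnd ℂ) z) := by
  rw [thetaInt, thetaInt, Complex.conj_tsum]
  refine tsum_congr fun n => ?_
  rw [← Complex.exp_conj]
  simp

lemma conj_thetaHalf (L : ℝ) (z : ℂ) :
    (starRingEnd ℂ) (thetaHalf L z) = thetaHalf L ((starRingEnd ℂ) z) := by
  rw [thetaHalf_eq, thetaHalf_eq, map_mul, conj_thetaInt, ← Complex.exp_conj]
  simp [map_ofNat]

lemma thetaInt_ofReal (L x : ℝ) :
    thetaInt L x = ((∑' n : ℤ, Real.exp (-L * n ^ 2 + n * x) : ℝ) : ℂ) := by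
  rw [thetaInt, Complex.ofReal_tsum]
  push_cast
  rfl

lemma re_thetaInt_ofReal_pos {L : ℝ} (hL : 0 < L) (x : ℝ) : 0 < (thetaInt L x).re := by
  have h := hasSum_thetaInt hL (x : ℂ)
  have h2 : HasSum (fun n : ℤ => Real.exp (-L * n ^ 2 + n * x)) (thetaInt L x).re := by
    rw [thetaInt_ofReal] at h ⊢
    rw [Complex.ofReal_re, ← Complex.hasSum_ofReal]
    exact_mod_cast h
  rw [← h2.tsum_eq]
  exact h2.summable.tsum_pos (fun n => (Real.exp_pos _).le) 0 (Real.exp_pos _)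

lemma im_thetaInt_ofReal (L x : ℝ) : (thetaInt L x).im = 0 := by
  rw [thetaInt_ofReal, Complex.ofReal_im]

lemma HasSum.mul_prod {f g : ℤ → ℂ} {a b : ℂ} (hf : HasSum f a) (hg : HasSum g b) :
    HasSum (fun p : ℤ × ℤ => f p.1 * g p.2) (a * b) :=
  hf.mul hg (summable_mul_of_summable_norm hf.summable.norm hg.summable.norm)

/-- The index bijection `ℤ² ⊔ ℤ² ≃ ℤ²` underlying the doubling identity. -/
def parityEquiv : (ℤ × ℤ) ⊕ (ℤ × ℤ) ≃ ℤ × ℤ where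
  toFun := Sum.elim (fun p => (p.1 + p.2, p.1 - p.2)) (fun p => (p.1 + p.2 + 1, p.1 - p.2))
  invFun p := if (p.1 + p.2) % 2 = 0 then Sum.inl ((p.1 + p.2) / 2, (p.1 - p.2) / 2)
    else Sum.inr ((p.1 + p.2 - 1) / 2, (p.1 - p.2 - 1) / 2)
  left_inv := by
    rintro (⟨a, b⟩ | ⟨a, b⟩)
    · have h : (a + b + (a - b)) % 2 = 0 := by omega
      simp only [Sum.elim_inl, h, if_true, Sum.inl.injEq, Prod.mk.injEq]
      omega
    · have h : ¬ (a + b + 1 + (a - b)) % 2 = 0 := by omega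
      simp only [Sum.elim_inr, h, if_false, Sum.inr.injEq, Prod.mk.injEq]
      omega
  right_inv := by
    rintro ⟨a, b⟩
    by_cases h : (a + b) % 2 = 0
    · simp only [h, if_true, Sum.elim_inl, Prod.mk.injEq]
      omega
    · simp only [h, if_false, Sum.elim_inr, Prod.mk.injEq]
      omega

/-- The doubling identity for theta series. -/
lemma thetaInt_mul_add_thetaHalf_mul {L : ℝ} (hL : 0 < L) (z w : ℂ) :
    thetaInt (2 * L) (z + w) * thetaInt (2 * L) (z - w) +
      thetaHalf (2 * L) (z + w) * thetaHalf (2 * L) (z - w) = thetaInt L z * thetaInt L w := by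
  have h2 : 0 < 2 * L := by positivity
  have h := (hasSum_thetaInt hL z).mul_prod (hasSum_thetaInt hL w)
  rw [← parityEquiv.hasSum_iff] at h
  refine HasSum.unique (HasSum.sum ?_ ?_) h
  · convert (hasSum_thetaInt h2 (z + w)).mul_prod (hasSum_thetaInt h2 (z - w)) using 2 with p
    simp only [Function.comp, parityEquiv, Equiv.coe_fn_mk, Sum.elim_inl, ← Complex.exp_add]
    congr 1
    push_cast
    ring
  · convert (hasSum_thetaHalf h2 (z + w)).mul_prod (hasSum_thetaHalf h2 (z - w)) using 2 with p
    simp only [Function.comp, parityEquiv, Equiv.coe_fn_mk, Sum.elim_inr, ← Complex.exp_add]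
    congr 1
    push_cast
    ring

lemma thetaHalf_mul_thetaHalf {L : ℝ} (hL : 0 < L) (z w : ℂ) :
    thetaHalf L z * thetaHalf L w = thetaHalf (2 * L) (z + w) * thetaInt (2 * L) (z - w) +
      thetaInt (2 * L) (z + w) * thetaHalf (2 * L) (z - w) := by
  have h := thetaInt_mul_add_thetaHalf_mul hL (z - L) (w - L)
  have h1 := thetaHalf_eq (2 * L) (z + w)
  have h2 := thetaHalf_sub (2 * L) (z + w)
  push_cast at h1 h2
  rw [show z - (L : ℂ) + (w - L) = z + w - 2 * L by ring,
    show z - (L : ℂ) - (w - L) = z - w by ring, h2] at h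
  rw [thetaHalf_eq L z, thetaHalf_eq L w, h1]
  have e1 : Complex.exp (-L / 4 + z / 2) * Complex.exp (-L / 4 + w / 2) =
      Complex.exp (-(2 * L) / 4 + (z + w) / 2) := by
    rw [← Complex.exp_add]; congr 1; ring
  have e2 : Complex.exp (-(2 * L) / 4 + (z + w) / 2) * Complex.exp (2 * L / 4 - (z + w) / 2) =
      1 := by
    rw [← Complex.exp_add, ← Complex.exp_zero]; congr 1; ring
  linear_combination (thetaInt L (z - L) * thetaInt L (w - L)) * e1 -
    Complex.exp (-(2 * L) / 4 + (z + w) / 2) * h +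
    thetaInt (2 * L) (z + w) * thetaHalf (2 * L) (z - w) * e2

lemma thetaHalf_mul_thetaHalf_zero {L : ℝ} (hL : 0 < L) (z : ℂ) :
    thetaHalf L z * thetaHalf L 0 = 2 * thetaInt (2 * L) z * thetaHalf (2 * L) z := by
  rw [thetaHalf_mul_thetaHalf hL]
  simp only [add_zero, sub_zero]
  ring

lemma thetaInt_sq_add_thetaHalf_sq {L : ℝ} (hL : 0 < L) (z : ℂ) :
    thetaInt (2 * L) z ^ 2 + thetaHalf (2 * L) z ^ 2 = thetaInt L z * thetaInt L 0 := by
  rw [← thetaInt_mul_add_thetaHalf_mul hL]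
  simp only [add_zero, sub_zero]
  ring

lemma thetaHalf_ofReal_eq (L x : ℝ) :
    thetaHalf L x = ((Real.exp (-L / 4 + x / 2) * (thetaInt L ((x - L : ℝ) : ℂ)).re : ℝ) : ℂ) := by
  rw [thetaHalf_eq, Complex.ofReal_mul]
  congr 1
  · push_cast; rfl
  · apply Complex.ext
    · simp
    · rw [← Complex.ofReal_sub, im_thetaInt_ofReal, Complex.ofReal_im]

lemma re_thetaHalf_ofReal_pos {L : ℝ} (hL : 0 < L) (x : ℝ) : 0 < (thetaHalf L x).re := by
  rw [thetaHalf_ofReal_eq, Complex.ofReal_re]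
  exact mul_pos (Real.exp_pos _) (re_thetaInt_ofReal_pos hL _)

lemma im_thetaHalf_ofReal (L x : ℝ) : (thetaHalf L x).im = 0 := by
  rw [thetaHalf_ofReal_eq, Complex.ofReal_im]

lemma thetaHalf_zero_ne_zero {L : ℝ} (hL : 0 < L) : thetaHalf L 0 ≠ 0 := fun h => by
  have := re_thetaHalf_ofReal_pos hL 0
  simp [h] at this

lemma thetaHalf_pi_mul_I (L : ℝ) : thetaHalf L (π * I) = 0 := by
  have h := thetaHalf_add_two_pi_I L (-(π * I))
  rw [show -(π * I) + 2 * π * I = (π * I : ℂ) by ring, thetaHalf_neg] at h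
  exact self_eq_neg.mp h

lemma summable_exp_triangular :
    Summable (fun n : ℤ => Real.exp (-(((n : ℝ) ^ 2 - n) / 2))) := by
  have h := (hasSum_thetaInt (L := 1 / 2) (by norm_num) (1 / 2)).summable
  have h2 : Summable (fun n : ℤ => Real.exp (-(1 / 2) * n ^ 2 + n * (1 / 2))) := by
    rw [← Complex.summable_ofReal]
    convert h using 2 with n
    push_cast
    rfl
  convert h2 using 2 with n
  ring_nf

/-- Away from the zeros the theta series is dominated by its two largest terms. -/
lemma norm_thetaInt_sub_le {L : ℝ} (hL : 1 ≤ L) {z : ℂ} (h0 : 0 ≤ z.re) (h1 : z.re ≤ L) :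
    ‖thetaInt L z - 1 - Complex.exp (z - L)‖ ≤
      Real.exp (1 - L) * ∑' n : ℤ, Real.exp (-(((n : ℝ) ^ 2 - n) / 2)) := by
  have hs := ((hasSum_thetaInt (by linarith : 0 < L) z).sub
    (hasSum_ite_eq (0 : ℤ) (1 : ℂ))).sub (hasSum_ite_eq (1 : ℤ) (Complex.exp (z - L)))
  refine hs.tsum_eq ▸ tsum_of_norm_bounded (summable_exp_triangular.hasSum.mul_left _) fun n => ?_
  by_cases hn0 : n = 0
  · subst hn0
    simp
    positivity
  by_cases hn1 : n = 1
  · subst hn1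
    have : -(L : ℂ) + z = z - L := by ring
    simp [this]
    positivity
  simp only [hn0, hn1, if_false, sub_zero, Complex.norm_exp, ← Real.exp_add]
  apply Real.exp_le_exp.mpr
  have hre : (-(L : ℂ) * n ^ 2 + n * z).re = -L * n ^ 2 + n * z.re := by
    have : (-(L : ℂ) * n ^ 2) = ((-L * n ^ 2 : ℝ) : ℂ) := by push_cast; ring
    rw [Complex.add_re, this, Complex.ofReal_re, ← Complex.ofReal_intCast, Complex.re_ofReal_mul]
  rw [hre]
  rcases lt_or_gt_of_ne hn0 with h | h
  · have hn : (n : ℝ) ≤ -1 := by exact_mod_cast (by omega : n ≤ -1)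
    nlinarith [mul_nonneg (sub_nonneg.2 hL) (by nlinarith : (0 : ℝ) ≤ (n : ℝ) ^ 2 + n),
      mul_nonneg (sub_nonneg.2 hL) (by nlinarith : (0 : ℝ) ≤ (n : ℝ) ^ 2 - 1)]
  · have hn : (2 : ℝ) ≤ n := by exact_mod_cast (by omega : 2 ≤ n)
    nlinarith [mul_nonneg (sub_nonneg.2 hL) (by nlinarith : (0 : ℝ) ≤ (n : ℝ) ^ 2 - n - 2),
      mul_nonneg (sub_nonneg.2 h1) (by linarith : (0 : ℝ) ≤ n)]

lemma norm_thetaHalf_sub_le_of_nonneg {L : ℝ} (hL : 1 ≤ L) {z : ℂ} (h0 : 0 ≤ z.re)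
    (h1 : z.re ≤ L) :
    ‖Complex.exp (L / 4) * thetaHalf L z - (Complex.exp (z / 2) + Complex.exp (-z / 2))‖ ≤
      Real.exp (z.re / 2) *
        (Real.exp (1 - L) * ∑' n : ℤ, Real.exp (-(((n : ℝ) ^ 2 - n) / 2))) := by
  have h := norm_thetaInt_sub_le hL (z := L - z) (by simpa using h1) (by simpa using h0)
  have e : Complex.exp (L / 4) * thetaHalf L z - (Complex.exp (z / 2) + Complex.exp (-z / 2)) =
      Complex.exp (z / 2) * (thetaInt L (L - z) - 1 - Complex.exp (L - z - L)) := by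
    rw [thetaHalf_eq, ← thetaInt_neg L (z - L), neg_sub, ← mul_assoc, ← Complex.exp_add, mul_sub,
      mul_sub, ← Complex.exp_add, mul_one]
    ring_nf
  rw [e, norm_mul, Complex.norm_exp]
  refine mul_le_mul (le_of_eq ?_) h (norm_nonneg _) (Real.exp_pos _).le
  simp

lemma norm_thetaHalf_sub_le {L : ℝ} (hL : 1 ≤ L) {z : ℂ} (h : |z.re| ≤ L) :
    ‖Complex.exp (L / 4) * thetaHalf L z - (Complex.exp (z / 2) + Complex.exp (-z / 2))‖ ≤
      Real.exp (|z.re| / 2) *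
        (Real.exp (1 - L) * ∑' n : ℤ, Real.exp (-(((n : ℝ) ^ 2 - n) / 2))) := by
  rcases le_total 0 z.re with h0 | h0
  · rw [abs_of_nonneg h0] at h ⊢
    exact norm_thetaHalf_sub_le_of_nonneg hL h0 h
  · rw [abs_of_nonpos h0] at h ⊢
    have := norm_thetaHalf_sub_le_of_nonneg hL (z := -z) (by simpa using h0) (by simpa using h)
    rw [thetaHalf_neg, neg_neg, add_comm (Complex.exp (-z / 2))] at this
    simpa using this

open Filter Topology in
lemma tendsto_two_pow_mul {L : ℝ} (hL : 0 < L) :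
    Tendsto (fun N : ℕ => 2 ^ N * L) atTop atTop :=
  (tendsto_pow_atTop_atTop_of_one_lt (by norm_num)).atTop_mul_const hL

open Filter Topology in
lemma tendsto_exp_one_sub_mul (C : ℝ) :
    Tendsto (fun L : ℝ => Real.exp (1 - L) * C) atTop (𝓝 0) := by
  have : Tendsto (fun L : ℝ => 1 - L) atTop atBot :=
    tendsto_const_nhds.add_atBot tendsto_neg_atTop_atBot
  simpa using (Real.tendsto_exp_atBot.comp this).mul_const C

lemma thetaInt_eq_zero_double {L : ℝ} (hL : 0 < L) {z : ℂ} (h : thetaInt L z = 0) :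
    thetaInt (2 * L) (z - L) = 0 ∨ thetaInt (2 * L) (z + L) = 0 := by
  have h1 := thetaHalf_mul_thetaHalf_zero hL (z - L)
  have h2 := thetaHalf_sub (2 * L) (z + L)
  rw [thetaHalf_sub, h, mul_zero, zero_mul] at h1
  push_cast at h2
  rw [show z + (L : ℂ) - 2 * L = z - L by ring] at h2
  rw [h2] at h1
  simpa [Complex.exp_ne_zero] using h1

lemma thetaInt_eq_zero_pow {L δ : ℝ} (hL : 0 < L) {z : ℂ} (h : thetaInt L z = 0)
    (hz : |z.re| ≤ L - δ) (N : ℕ) :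
    ∃ w : ℂ, thetaInt (2 ^ N * L) w = 0 ∧ |w.re| ≤ 2 ^ N * L - δ := by
  induction N with
  | zero => exact ⟨z, by simpa using h, by simpa using hz⟩
  | succ N ih =>
    obtain ⟨w, hw, hwr⟩ := ih
    have hp : 0 < 2 ^ N * L := by positivity
    have e : 2 ^ (N + 1) * L = 2 * (2 ^ N * L) := by ring
    rw [abs_le] at hwr
    rcases thetaInt_eq_zero_double hp hw with h | h
    · refine ⟨_, e ▸ h, ?_⟩
      rw [e, Complex.sub_re, Complex.ofReal_re, abs_le]
      constructor <;> linarith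
    · refine ⟨_, e ▸ h, ?_⟩
      rw [e, Complex.add_re, Complex.ofReal_re, abs_le]
      constructor <;> linarith

open Filter Topology in
lemma thetaInt_ne_zero {L : ℝ} (hL : 0 < L) {z : ℂ} (hz : |z.re| < L) : thetaInt L z ≠ 0 := by
  intro h
  obtain ⟨δ, hδ, hzδ⟩ : ∃ δ > 0, |z.re| ≤ L - δ := ⟨L - |z.re|, by linarith, by linarith⟩
  set C := ∑' n : ℤ, Real.exp (-(((n : ℝ) ^ 2 - n) / 2))
  have hpos : 0 < 1 - Real.exp (-δ) := by
    rw [sub_pos, Real.exp_lt_one_iff]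
    linarith
  obtain ⟨N, hN1, hN2⟩ := (((tendsto_two_pow_mul hL).eventually_ge_atTop 1).and
    (((tendsto_exp_one_sub_mul C).comp (tendsto_two_pow_mul hL)).eventually_lt_const hpos)).exists
  obtain ⟨w, hw, hwr⟩ := thetaInt_eq_zero_pow hL h hzδ N
  obtain ⟨v, hv, hv0, hvr⟩ : ∃ v : ℂ, thetaInt (2 ^ N * L) v = 0 ∧ 0 ≤ v.re ∧
      v.re ≤ 2 ^ N * L - δ := by
    rcases le_total 0 w.re with h0 | h0
    · exact ⟨w, hw, h0, (le_abs_self _).trans hwr⟩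
    · exact ⟨-w, by rw [thetaInt_neg, hw], by simpa using h0, by
        simpa using (neg_le_abs _).trans hwr⟩
  have hb := norm_thetaInt_sub_le hN1 hv0 (by linarith)
  rw [hv, zero_sub] at hb
  have h3 : 1 - ‖Complex.exp (v - (2 ^ N * L : ℝ))‖ ≤
      ‖-1 - Complex.exp (v - (2 ^ N * L : ℝ))‖ := by
    simpa using norm_sub_norm_le (-1 : ℂ) (Complex.exp (v - (2 ^ N * L : ℝ)))
  have h4 : ‖Complex.exp (v - (2 ^ N * L : ℝ))‖ ≤ Real.exp (-δ) := by
    rw [Complex.norm_exp, Real.exp_le_exp, Complex.sub_re, Complex.ofReal_re]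
    linarith
  simp only [Function.comp] at hN2
  linarith

lemma thetaHalf_ne_zero {L : ℝ} (hL : 0 < L) {z : ℂ} (h0 : 0 < z.re) (h1 : z.re < 2 * L) :
    thetaHalf L z ≠ 0 := by
  rw [thetaHalf_eq]
  refine mul_ne_zero (Complex.exp_ne_zero _) (thetaInt_ne_zero hL ?_)
  rw [Complex.sub_re, Complex.ofReal_re, abs_lt]
  constructor <;> linarith

open Filter Topology in
lemma exp_eq_neg_one_of_thetaHalf_eq_zero {L : ℝ} (hL : 0 < L) {z : ℂ} (hz : z.re = 0)
    (h : thetaHalf L z = 0) : Complex.exp z = -1 := by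
  have hN : ∀ N : ℕ, thetaHalf (2 ^ N * L) z = 0 := by
    intro N
    induction N with
    | zero => simpa using h
    | succ N ih =>
      have hp : 0 < 2 ^ N * L := by positivity
      have h1 := thetaHalf_mul_thetaHalf_zero hp z
      have h2 : thetaInt (2 * (2 ^ N * L)) z ≠ 0 :=
        thetaInt_ne_zero (by positivity) (by rw [hz, abs_zero]; positivity)
      rw [ih, zero_mul] at h1
      rw [show 2 ^ (N + 1) * L = 2 * (2 ^ N * L) by ring]
      simpa [h2] using h1.symm
  set C := ∑' n : ℤ, Real.exp (-(((n : ℝ) ^ 2 - n) / 2))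
  have hle : ‖Complex.exp (z / 2) + Complex.exp (-z / 2)‖ ≤ 0 := by
    refine ge_of_tendsto ((tendsto_exp_one_sub_mul C).comp (tendsto_two_pow_mul hL)) ?_
    filter_upwards [(tendsto_two_pow_mul hL).eventually_ge_atTop 1] with N h1
    have := norm_thetaHalf_sub_le h1 (z := z) (by rw [hz, abs_zero]; positivity)
    rw [hN, mul_zero, zero_sub, norm_neg, hz] at this
    simpa using this
  have h0 := norm_le_zero_iff.mp hle
  have e : Complex.exp z = Complex.exp (z / 2) * Complex.exp (z / 2) := by
    rw [← Complex.exp_add]; congr 1; ring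
  have e' : Complex.exp (z / 2) * Complex.exp (-z / 2) = 1 := by
    rw [← Complex.exp_add, ← Complex.exp_zero]; congr 1; ring
  linear_combination e + Complex.exp (z / 2) * h0 - e'

open Filter Topology in
lemma tendsto_thetaInt_of_re_eq_zero {z : ℂ} (hz : z.re = 0) :
    Tendsto (fun L : ℝ => thetaInt L z) atTop (𝓝 1) := by
  set C := ∑' n : ℤ, Real.exp (-(((n : ℝ) ^ 2 - n) / 2))
  have h2 : Tendsto (fun L : ℝ => Complex.exp (z - L)) atTop (𝓝 0) := by
    rw [tendsto_zero_iff_norm_tendsto_zero]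
    simp only [Complex.norm_exp, Complex.sub_re, hz, Complex.ofReal_re, zero_sub]
    exact Real.tendsto_exp_neg_atTop_nhds_zero
  have h1 : Tendsto (fun L : ℝ => thetaInt L z - 1 - Complex.exp (z - L)) atTop (𝓝 0) := by
    refine squeeze_zero_norm' ?_ (tendsto_exp_one_sub_mul C)
    filter_upwards [eventually_ge_atTop 1] with L hL
    exact norm_thetaInt_sub_le hL hz.ge (by rw [hz]; linarith)
  simpa using (h1.add h2).add_const 1

open Filter Topology in
lemma tendsto_thetaHalf (z : ℂ) :
    Tendsto (fun L : ℝ => Complex.exp (L / 4) * thetaHalf L z) atTop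
      (𝓝 (Complex.exp (z / 2) + Complex.exp (-z / 2))) := by
  rw [tendsto_iff_norm_sub_tendsto_zero]
  set C := ∑' n : ℤ, Real.exp (-(((n : ℝ) ^ 2 - n) / 2)) with hC
  have := (tendsto_exp_one_sub_mul C).const_mul (Real.exp (|z.re| / 2))
  rw [mul_zero] at this
  refine squeeze_zero' (Eventually.of_forall fun _ => norm_nonneg _) ?_ this
  filter_upwards [eventually_ge_atTop 1, eventually_ge_atTop |z.re|] with L hL hL2
  exact norm_thetaHalf_sub_le hL hL2

open Filter Topology in
lemma tendsto_deriv_thetaHalf :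
    Tendsto (fun L : ℝ => Complex.exp (L / 4) * deriv (thetaHalf L) (π * I)) atTop (𝓝 I) := by
  rw [tendsto_iff_norm_sub_tendsto_zero]
  set C := ∑' n : ℤ, Real.exp (-(((n : ℝ) ^ 2 - n) / 2)) with hC
  have := (tendsto_exp_one_sub_mul C).const_mul (Real.exp (1 / 2))
  rw [mul_zero] at this
  refine squeeze_zero' (Eventually.of_forall fun _ => norm_nonneg _) ?_ this
  filter_upwards [eventually_ge_atTop 1] with L hL
  set g : ℂ → ℂ := fun z =>
    Complex.exp (L / 4) * thetaHalf L z - (Complex.exp (z / 2) + Complex.exp (-z / 2)) with hg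
  have hd := differentiable_thetaHalf (by linarith : 0 < L)
  have hgd : Differentiable ℂ g := by fun_prop
  have hder : deriv g (π * I) = Complex.exp (L / 4) * deriv (thetaHalf L) (π * I) - I := by
    have h1 := ((hd (π * I)).hasDerivAt.const_mul (Complex.exp (L / 4)))
    have h2 : HasDerivAt (fun z : ℂ => Complex.exp (z / 2)) (Complex.exp (π * I / 2) * (1 / 2))
        (π * I) := ((hasDerivAt_id _).div_const 2).cexp
    have h3 : HasDerivAt (fun z : ℂ => Complex.exp (-z / 2))
        (Complex.exp (-(π * I) / 2) * (-1 / 2)) (π * I) := ((hasDerivAt_id _).neg.div_const 2).cexp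
    have h4 : HasDerivAt g _ (π * I) := h1.sub (h2.add h3)
    rw [h4.deriv, neg_div, Complex.exp_neg,
      show (π * I / 2 : ℂ) = π / 2 * I by ring, Complex.exp_pi_div_two_mul_I, Complex.inv_I]
    ring
  rw [← hder]
  refine (Complex.norm_deriv_le_of_forall_mem_sphere_norm_le one_pos hgd.diffContOnCl
    (C := Real.exp (1 / 2) * (Real.exp (1 - L) * C)) fun z hz => ?_).trans (by rw [div_one])
  have hre : |z.re| ≤ 1 := by
    have := Complex.abs_re_le_norm (z - π * I)
    rw [mem_sphere_iff_norm.mp hz] at this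
    simpa using this
  refine (norm_thetaHalf_sub_le hL (hre.trans hL)).trans ?_
  have : 0 ≤ Real.exp (1 - L) * C := mul_nonneg (Real.exp_pos _).le
    (tsum_nonneg fun _ => (Real.exp_pos _).le)
  gcongr

lemma two_mul_thetaInt_mul_deriv_thetaHalf {L : ℝ} (hL : 0 < L) :
    2 * thetaInt (2 * L) (π * I) * deriv (thetaHalf (2 * L)) (π * I) =
      thetaHalf L 0 * deriv (thetaHalf L) (π * I) := by
  have h2L : 0 < 2 * L := by positivity
  have h1 := (differentiable_thetaHalf hL (π * I)).hasDerivAt.mul_const (thetaHalf L 0)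
  have h2 := ((differentiable_thetaInt h2L (π * I)).hasDerivAt.const_mul 2).mul
    (differentiable_thetaHalf h2L (π * I)).hasDerivAt
  have h3 := h1.unique (h2.congr_of_eventuallyEq
    (Filter.Eventually.of_forall (thetaHalf_mul_thetaHalf_zero hL)))
  rw [thetaHalf_pi_mul_I, mul_zero, zero_add] at h3
  rw [← h3, mul_comm]

lemma thetaInt_two_mul_pi_mul_I_sq {L : ℝ} (hL : 0 < L) :
    thetaInt (2 * L) (π * I) ^ 2 = thetaInt L (π * I) * thetaInt L 0 := by
  rw [← thetaInt_sq_add_thetaHalf_sq hL, thetaHalf_pi_mul_I]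
  ring

lemma thetaInt_pi_mul_I_ne_zero {L : ℝ} (hL : 0 < L) : thetaInt L (π * I) ≠ 0 :=
  thetaInt_ne_zero hL (by simpa using hL)

/-- The ratio whose constancy is equivalent to Jacobi's derivative formula. -/
def jacobiRatio (L : ℝ) : ℂ :=
  deriv (thetaHalf (2 * L)) (π * I) / (thetaInt (2 * L) (π * I) * thetaHalf L 0 ^ 2)

lemma jacobiRatio_two_mul {L : ℝ} (hL : 0 < L) : jacobiRatio (2 * L) = jacobiRatio L := by
  have h2L : 0 < 2 * L := by positivity
  have h4L : 0 < 2 * (2 * L) := by positivity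
  have e1 := two_mul_thetaInt_mul_deriv_thetaHalf h2L
  have e2 := thetaInt_two_mul_pi_mul_I_sq h2L
  have e3 := thetaHalf_mul_thetaHalf_zero hL 0
  have n1 := thetaInt_pi_mul_I_ne_zero h2L
  have n2 := thetaInt_pi_mul_I_ne_zero h4L
  have n3 := thetaHalf_zero_ne_zero hL
  have n4 := thetaHalf_zero_ne_zero h2L
  rw [jacobiRatio, jacobiRatio, div_eq_div_iff (by positivity) (by positivity)]
  refine mul_left_cancel₀ (mul_ne_zero two_ne_zero n2) ?_
  rw [pow_two (thetaHalf L 0), e3]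
  linear_combination (thetaInt (2 * L) (π * I) * (2 * thetaInt (2 * L) 0 * thetaHalf (2 * L) 0)) *
    e1 - 2 * deriv (thetaHalf (2 * L)) (π * I) * thetaHalf (2 * L) 0 ^ 2 * e2

open Filter Topology in
lemma tendsto_jacobiRatio : Tendsto jacobiRatio atTop (𝓝 (I / 4)) := by
  have hd : Tendsto (fun L : ℝ => 2 * L) atTop atTop :=
    tendsto_id.const_mul_atTop two_pos
  have h1 := tendsto_deriv_thetaHalf.comp hd
  have h2 := (tendsto_thetaInt_of_re_eq_zero (z := π * I) (by simp)).comp hd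
  have h3 := (tendsto_thetaHalf 0).pow 2
  have h4 := h1.div (h2.mul h3) (by norm_num)
  norm_num at h4
  refine h4.congr fun L => ?_
  have e : Complex.exp (L / 4) ^ 2 = Complex.exp ((2 * L : ℝ) / 4) := by
    rw [← Complex.exp_nat_mul]; congr 1; push_cast; ring
  simp only [Pi.div_apply, Function.comp, jacobiRatio]
  rw [mul_pow, e, mul_left_comm, mul_div_mul_left _ _ (Complex.exp_ne_zero _)]

open Filter Topology in
lemma jacobiRatio_eq {L : ℝ} (hL : 0 < L) : jacobiRatio L = I / 4 := by
  have h : ∀ N : ℕ, jacobiRatio (2 ^ N * L) = jacobiRatio L := by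
    intro N
    induction N with
    | zero => simp
    | succ N ih => rw [pow_succ', mul_assoc, jacobiRatio_two_mul (by positivity), ih]
  refine tendsto_nhds_unique ?_ (tendsto_jacobiRatio.comp (tendsto_two_pow_mul hL))
  simp only [Function.comp_def, h]
  exact tendsto_const_nhds

lemma deriv_thetaHalf_pi_mul_I {L : ℝ} (hL : 0 < L) :
    deriv (thetaHalf (2 * L)) (π * I) = I / 4 * (thetaInt (2 * L) (π * I) * thetaHalf L 0 ^ 2) := by
  have n1 := thetaInt_pi_mul_I_ne_zero (L := 2 * L) (by positivity)
  have n3 := thetaHalf_zero_ne_zero hL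
  rw [← jacobiRatio_eq hL, jacobiRatio, div_mul_cancel₀ _ (by positivity)]

/-- The elliptic function parametrising the step kernel of the diagonal walk. -/
def thetaQuot (L : ℝ) (z : ℂ) : ℂ := thetaInt (2 * L) z / thetaHalf (2 * L) z

lemma thetaQuot_add_two_pi_I (L : ℝ) (z : ℂ) :
    thetaQuot L (z + 2 * π * I) = -thetaQuot L z := by
  rw [thetaQuot, thetaInt_add_two_pi_I, thetaHalf_add_two_pi_I, div_neg, thetaQuot]

lemma thetaQuot_neg (L : ℝ) (z : ℂ) : thetaQuot L (-z) = thetaQuot L z := by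
  rw [thetaQuot, thetaInt_neg, thetaHalf_neg, thetaQuot]

lemma thetaQuot_sub_two_mul (L : ℝ) (z : ℂ) : thetaQuot L (z - 2 * L) = (thetaQuot L z)⁻¹ := by
  have h1 := thetaHalf_eq (2 * L) z
  have h2 := thetaHalf_sub (2 * L) z
  push_cast at h1 h2
  rw [thetaQuot, thetaQuot, h2, h1, inv_div, show -(2 * (L : ℂ)) / 4 + z / 2 =
    -(2 * L / 4 - z / 2) by ring, Complex.exp_neg]
  field_simp [Complex.exp_ne_zero]

lemma thetaQuot_sub_four_mul (L : ℝ) (z : ℂ) : thetaQuot L (z - 4 * L) = thetaQuot L z := by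
  rw [show z - 4 * (L : ℂ) = z - 2 * L - 2 * L by ring, thetaQuot_sub_two_mul,
    thetaQuot_sub_two_mul, inv_inv]

lemma thetaQuot_four_mul_sub (L : ℝ) (z : ℂ) : thetaQuot L (4 * L - z) = thetaQuot L z := by
  rw [← thetaQuot_neg, neg_sub, thetaQuot_sub_four_mul]

lemma conj_thetaQuot (L : ℝ) (z : ℂ) :
    (starRingEnd ℂ) (thetaQuot L z) = thetaQuot L ((starRingEnd ℂ) z) := by
  rw [thetaQuot, map_div₀, conj_thetaInt, conj_thetaHalf, thetaQuot]

lemma thetaHalf_two_mul_ne_zero {L : ℝ} (hL : 0 < L) {z : ℂ} (h0 : 0 < z.re) (h8 : z.re < 8 * L)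
    (h : Complex.exp (z - 4 * L) ≠ -1) : thetaHalf (2 * L) z ≠ 0 := by
  have h2L : 0 < 2 * L := by positivity
  rcases lt_or_ge z.re (4 * L) with h4 | h4
  · exact thetaHalf_ne_zero h2L h0 (by linarith)
  have h1 := thetaHalf_eq (2 * L) z
  have h2 := thetaHalf_sub (2 * L) (z - 2 * L)
  push_cast at h1 h2
  have hre : (z - 4 * L : ℂ).re = z.re - 4 * L := by simp
  have hne : thetaHalf (2 * L) (z - 4 * L) ≠ 0 := by
    rcases h4.eq_or_lt with h4 | h4
    · exact fun h0 => h (exp_eq_neg_one_of_thetaHalf_eq_zero h2L (by rw [hre]; linarith) h0)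
    · exact thetaHalf_ne_zero h2L (by rw [hre]; linarith) (by rw [hre]; linarith)
  rw [show z - 2 * (L : ℂ) - 2 * L = z - 4 * L by ring] at h2
  rw [h2] at hne
  rw [h1]
  exact mul_ne_zero (Complex.exp_ne_zero _) (right_ne_zero_of_mul hne)

lemma differentiableAt_thetaQuot {L : ℝ} (hL : 0 < L) {z : ℂ} (h0 : 0 < z.re)
    (h8 : z.re < 8 * L) (h : Complex.exp (z - 4 * L) ≠ -1) :
    DifferentiableAt ℂ (thetaQuot L) z :=
  (differentiable_thetaInt (by positivity) z).div (differentiable_thetaHalf (by positivity) z)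
    (thetaHalf_two_mul_ne_zero hL h0 h8 h)

lemma exp_ne_neg_one_of_re_ne_zero {z : ℂ} (h : z.re ≠ 0) : Complex.exp z ≠ -1 := fun he => by
  have := congrArg norm he
  rw [Complex.norm_exp, norm_neg, norm_one, Real.exp_eq_one_iff] at this
  exact h this

lemma differentiableAt_thetaQuot_of_lt {L : ℝ} (hL : 0 < L) {z : ℂ} (h0 : 0 < z.re)
    (h4 : z.re < 4 * L) : DifferentiableAt ℂ (thetaQuot L) z :=
  differentiableAt_thetaQuot hL h0 (by linarith)
    (exp_ne_neg_one_of_re_ne_zero (by simp; linarith))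

lemma thetaQuot_ne_zero {L : ℝ} (hL : 0 < L) {z : ℂ} (h0 : 0 < z.re) (h2 : z.re < 2 * L) :
    thetaQuot L z ≠ 0 :=
  div_ne_zero (thetaInt_ne_zero (by positivity) (by rw [abs_of_pos h0]; linarith))
    (thetaHalf_ne_zero (by positivity) h0 (by linarith))

lemma thetaQuot_two_mul_add_pi_mul_I (L : ℝ) : thetaQuot L (2 * L + π * I) = 0 := by
  rw [← inv_inv (thetaQuot L _), ← thetaQuot_sub_two_mul, add_sub_cancel_left, thetaQuot,
    thetaHalf_pi_mul_I]
  simp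

/-- The kernel equation. -/
lemma thetaQuot_mul_thetaQuot_sub {L t : ℝ} (hL : 0 < L)
    (ht : 4 * (t : ℂ) * thetaInt L 0 ^ 2 = thetaHalf L 0 ^ 2) {z : ℂ}
    (h1 : thetaHalf (2 * L) z ≠ 0) (h2 : thetaHalf (2 * L) (z - L) ≠ 0) :
    thetaQuot L z * thetaQuot L (z - L) =
      t * (thetaQuot L z ^ 2 + 1) * (thetaQuot L (z - L) ^ 2 + 1) := by
  have a1 := thetaHalf_mul_thetaHalf_zero hL z
  have a2 := thetaHalf_mul_thetaHalf_zero hL (z - L)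
  have b1 := thetaInt_sq_add_thetaHalf_sq hL z
  have b2 := thetaInt_sq_add_thetaHalf_sq hL (z - L)
  have c : thetaHalf L z * thetaHalf L (z - L) = thetaInt L z * thetaInt L (z - L) := by
    rw [thetaHalf_eq, thetaHalf_sub, mul_mul_mul_comm, ← Complex.exp_add,
      show -(L : ℂ) / 4 + z / 2 + (L / 4 - z / 2) = 0 by ring, Complex.exp_zero]
    ring
  have d : 4 * (thetaInt (2 * L) z * thetaHalf (2 * L) z *
      (thetaInt (2 * L) (z - L) * thetaHalf (2 * L) (z - L))) =
      4 * (t * (thetaInt (2 * L) z ^ 2 + thetaHalf (2 * L) z ^ 2) *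
      (thetaInt (2 * L) (z - L) ^ 2 + thetaHalf (2 * L) (z - L) ^ 2)) := by
    rw [b1, b2]
    linear_combination -(2 * thetaInt (2 * L) (z - L) * thetaHalf (2 * L) (z - L)) * a1
      - (thetaHalf L z * thetaHalf L 0) * a2 + thetaHalf L 0 ^ 2 * c
      - (thetaInt L z * thetaInt L (z - L)) * ht
  have d' := mul_left_cancel₀ (by norm_num : (4 : ℂ) ≠ 0) d
  rw [thetaQuot, thetaQuot]
  field_simp
  linear_combination d'

lemma thetaQuot_eq {L t : ℝ} (hL : 0 < L)
    (ht : 4 * (t : ℂ) * thetaInt L 0 ^ 2 = thetaHalf L 0 ^ 2) {z : ℂ}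
    (h1 : L < z.re) (h2 : z.re < 3 * L) :
    thetaQuot L z =
      t * (thetaQuot L z ^ 2 + 1) * (thetaQuot L (z + L) + thetaQuot L (z - L)) := by
  have hre : (z - L : ℂ).re = z.re - L := by simp
  have hk := thetaQuot_mul_thetaQuot_sub hL ht (z := z)
    (thetaHalf_ne_zero (by positivity) (by linarith) (by linarith))
    (thetaHalf_ne_zero (by positivity) (by linarith) (by linarith))
  have h0 := thetaQuot_ne_zero hL (z := z - L) (by linarith) (by linarith)
  have hi := thetaQuot_sub_two_mul L (z + L)
  rw [show z + (L : ℂ) - 2 * L = z - L by ring] at hi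
  rw [hi] at h0 hk ⊢
  have h0' := inv_ne_zero h0
  rw [inv_inv] at h0'
  field_simp at hk ⊢
  linear_combination hk

lemma re_ofReal_add_ofReal_mul_I (x y : ℝ) : ((x : ℂ) + y * I).re = x := by simp

lemma conj_ofReal_add_ofReal_mul_I (x y : ℝ) :
    (starRingEnd ℂ) ((x : ℂ) + y * I) = x - y * I := by
  simp [sub_eq_add_neg]

lemma thetaQuot_sub_eq_conj (L y : ℝ) :
    thetaQuot L ((5 / 2 * L : ℝ) + y * I - L) =
      (starRingEnd ℂ) (thetaQuot L ((5 / 2 * L : ℝ) + y * I)) := by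
  rw [conj_thetaQuot, conj_ofReal_add_ofReal_mul_I, ← thetaQuot_four_mul_sub]
  congr 1
  push_cast
  ring

lemma norm_thetaQuot_ne_one {L t : ℝ} (hL : 0 < L) (ht0 : 0 < t) (ht1 : t < 1 / 4)
    (ht : 4 * (t : ℂ) * thetaInt L 0 ^ 2 = thetaHalf L 0 ^ 2) (y : ℝ) :
    ‖thetaQuot L ((5 / 2 * L : ℝ) + y * I)‖ ≠ 1 := by
  intro h
  have hre := re_ofReal_add_ofReal_mul_I (5 / 2 * L) y
  have hk := thetaQuot_mul_thetaQuot_sub hL ht (z := (5 / 2 * L : ℝ) + y * I)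
    (thetaHalf_ne_zero (by positivity) (by linarith) (by linarith))
    (thetaHalf_ne_zero (by positivity) (by simp only [sub_re, ofReal_re]; linarith)
      (by simp only [sub_re, ofReal_re]; linarith))
  rw [thetaQuot_sub_eq_conj] at hk
  have hn := congrArg norm hk
  set X := thetaQuot L ((5 / 2 * L : ℝ) + y * I)
  have h1 : ‖X ^ 2 + 1‖ ≤ 2 := (norm_add_le _ _).trans (by rw [norm_pow, h]; norm_num)
  have h2 : ‖(starRingEnd ℂ) X ^ 2 + 1‖ ≤ 2 :=
    (norm_add_le _ _).trans (by rw [norm_pow, RCLike.norm_conj, h]; norm_num)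
  rw [norm_mul, RCLike.norm_conj, h, norm_mul, norm_mul, Complex.norm_real, Real.norm_of_nonneg
    ht0.le] at hn
  have h3 : ‖X ^ 2 + 1‖ * ‖(starRingEnd ℂ) X ^ 2 + 1‖ ≤ 2 * 2 :=
    mul_le_mul h1 h2 (norm_nonneg _) (by norm_num)
  nlinarith

lemma norm_thetaQuot_add_pi_mul_I_ne_one {L t : ℝ} (hL : 0 < L)
    (ht : 4 * (t : ℂ) * thetaInt L 0 ^ 2 = thetaHalf L 0 ^ 2) {x : ℝ} (h1 : L < x)
    (h2 : x < 3 * L) : ‖thetaQuot L (x + π * I)‖ ≠ 1 := by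
  intro h
  have hk := thetaQuot_eq hL ht (z := x + π * I) (by simpa using h1) (by simpa using h2)
  have hc : (starRingEnd ℂ) (thetaQuot L (x + π * I)) = -thetaQuot L (x + π * I) := by
    have h := thetaQuot_add_two_pi_I L (x - π * I)
    rw [show (x : ℂ) - π * I + 2 * π * I = x + π * I by ring] at h
    rw [conj_thetaQuot, conj_ofReal_add_ofReal_mul_I, h, neg_neg]
  have hsq : thetaQuot L (x + π * I) ^ 2 + 1 = 0 := by
    have := Complex.mul_conj (thetaQuot L (x + π * I))
    rw [hc, Complex.normSq_eq_norm_sq, h] at this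
    push_cast at this
    linear_combination -this
  rw [hsq] at hk
  rw [mul_zero, zero_mul] at hk
  rw [hk] at hsq
  norm_num at hsq

lemma norm_thetaQuot_lt_one {L t : ℝ} (hL : 0 < L) (ht0 : 0 < t) (ht1 : t < 1 / 4)
    (ht : 4 * (t : ℂ) * thetaInt L 0 ^ 2 = thetaHalf L 0 ^ 2) (y : ℝ) :
    ‖thetaQuot L ((5 / 2 * L : ℝ) + y * I)‖ < 1 := by
  have hbase : ‖thetaQuot L ((5 / 2 * L : ℝ) + π * I)‖ < 1 := by
    by_contra! hge
    have hc : ContinuousOn (fun x : ℝ => ‖thetaQuot L (x + π * I)‖) (Icc (2 * L) (5 / 2 * L)) := by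
      intro x hx
      have hd := differentiableAt_thetaQuot_of_lt hL (z := x + π * I)
        (by simp; linarith [hx.1]) (by simp; linarith [hx.2])
      exact (ContinuousAt.comp (f := fun x : ℝ => (x + π * I : ℂ)) hd.continuousAt
        (by fun_prop)).norm.continuousWithinAt
    obtain ⟨x, hx, hx1⟩ := intermediate_value_Icc (by linarith) hc
      (show (1 : ℝ) ∈ _ from ⟨by
        push_cast
        rw [thetaQuot_two_mul_add_pi_mul_I]; simp, hge⟩)
    exact norm_thetaQuot_add_pi_mul_I_ne_one hL ht (by linarith [hx.1]) (by linarith [hx.2]) hx1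
  have hc : Continuous fun y : ℝ => ‖thetaQuot L ((5 / 2 * L : ℝ) + y * I)‖ := by
    rw [continuous_iff_continuousAt]
    intro y
    have hd := differentiableAt_thetaQuot_of_lt hL (z := (5 / 2 * L : ℝ) + y * I)
      (by rw [re_ofReal_add_ofReal_mul_I]; linarith) (by rw [re_ofReal_add_ofReal_mul_I]; linarith)
    exact (ContinuousAt.comp (f := fun y : ℝ => ((5 / 2 * L : ℝ) + y * I : ℂ)) hd.continuousAt
      (by fun_prop)).norm
  by_contra! hge
  obtain ⟨x, hx⟩ := mem_range_of_exists_le_of_exists_ge hc ⟨π, hbase.le⟩ ⟨y, hge⟩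
  exact norm_thetaQuot_ne_one hL ht0 ht1 ht x hx

/-- The logistic function, with simple poles of residue one at the odd multiples of `π i`. -/
def logistic (z : ℂ) : ℂ := (1 + Complex.exp (-z))⁻¹

/-- The mean of a `2π i`-periodic function over a vertical line. -/
def lineMean (F : ℂ → ℂ) (a : ℝ) : ℂ := (2 * π)⁻¹ * ∫ y in (0 : ℝ)..2 * π, F (a + y * I)

lemma eq_pi_mul_I_of_exp_eq_neg_one {z : ℂ} (h : Complex.exp z = -1) (h0 : 0 ≤ z.im)
    (h1 : z.im ≤ 2 * π) : z = π * I := by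
  rw [← Complex.exp_pi_mul_I, Complex.exp_eq_exp_iff_exists_int] at h
  obtain ⟨n, hn⟩ := h
  have him := congrArg Complex.im hn
  simp at him
  have hπ := Real.pi_pos
  have hn1 : (n : ℝ) < 1 := by nlinarith
  have hn2 : (-1 : ℝ) < n := by nlinarith
  have : n = 0 := by
    have a : n < 1 := by exact_mod_cast hn1
    have b : -1 < n := by exact_mod_cast hn2
    omega
  simpa [this] using hn

lemma exp_neg_ne_neg_one {z : ℂ} (h : Complex.exp z ≠ -1) : Complex.exp (-z) ≠ -1 := fun he =>
  h (by rw [← neg_neg z, Complex.exp_neg, he]; norm_num)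

lemma one_add_exp_neg_ne_zero {z : ℂ} (h : Complex.exp z ≠ -1) : 1 + Complex.exp (-z) ≠ 0 :=
  fun he => exp_neg_ne_neg_one h (by linear_combination he)

lemma differentiableAt_logistic {z : ℂ} (h : Complex.exp z ≠ -1) :
    DifferentiableAt ℂ logistic z := by
  unfold logistic
  have := one_add_exp_neg_ne_zero h
  fun_prop (disch := assumption)

lemma logistic_neg {z : ℂ} (h : Complex.exp z ≠ -1) : logistic (-z) = 1 - logistic z := by
  have h1 := one_add_exp_neg_ne_zero h
  have h2 : 1 + Complex.exp z ≠ 0 := fun he => h (by linear_combination he)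
  have h3 : Complex.exp z * Complex.exp (-z) = 1 := by
    rw [← Complex.exp_add, add_neg_cancel, Complex.exp_zero]
  rw [logistic, logistic, neg_neg]
  field_simp
  linear_combination -h3

lemma logistic_add_two_pi_I (z : ℂ) : logistic (z + 2 * π * I) = logistic z := by
  rw [logistic, logistic, show -(z + 2 * π * I) = -z - 2 * π * I by ring,
    Complex.exp_sub, Complex.exp_two_pi_mul_I, div_one]

lemma logistic_ofReal_add_pi_mul_I (x : ℝ) :
    logistic (x + π * I) = ((1 - Real.exp (-x))⁻¹ : ℝ) := by
  rw [logistic, neg_add, Complex.exp_add, Complex.exp_neg (π * I), Complex.exp_pi_mul_I]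
  push_cast
  rw [show (-1 : ℂ)⁻¹ = -1 by norm_num, mul_neg_one, sub_eq_add_neg]

open Filter Topology in
lemma tendsto_mul_logistic :
    Tendsto (fun z => (z - π * I) * logistic z) (𝓝[≠] (π * I)) (𝓝 1) := by
  have h : HasDerivAt (fun z : ℂ => 1 + Complex.exp (-z)) 1 (π * I) := by
    have h1 : HasDerivAt (fun z : ℂ => -z) (-1) (π * I) := hasDerivAt_neg _
    have h2 := h1.cexp.const_add 1
    rw [Complex.exp_neg, Complex.exp_pi_mul_I, show (-1 : ℂ)⁻¹ * -1 = 1 by norm_num] at h2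
    exact h2
  have h2 := (hasDerivAt_iff_tendsto_slope.mp h).inv₀ one_ne_zero
  rw [inv_one] at h2
  refine h2.congr fun z => ?_
  have e : Complex.exp (-(π * I)) = -1 := by
    rw [Complex.exp_neg, Complex.exp_pi_mul_I]; norm_num
  rw [slope_def_field, logistic, e, inv_div]
  ring

lemma lineMean_logistic_of_neg {x : ℝ} (hx : x < 0) : lineMean logistic x = 0 := by
  have hs : ∀ y : ℝ, 1 + Complex.exp (x + y * I) ∈ slitPlane := by
    intro y
    refine Or.inl ?_
    have h1 := (Complex.abs_re_le_norm (Complex.exp (x + y * I)))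
    rw [Complex.norm_exp, re_ofReal_add_ofReal_mul_I] at h1
    have h2 := Real.exp_lt_one_iff.mpr hx
    have h3 := (abs_le.mp h1).1
    simp only [add_re, one_re]
    linarith
  have hne : ∀ y : ℝ, Complex.exp (x + y * I) ≠ -1 := fun y =>
    exp_ne_neg_one_of_re_ne_zero (by simpa using hx.ne)
  have hd : ∀ y : ℝ, HasDerivAt (fun y : ℝ => -I * Complex.log (1 + Complex.exp (x + y * I)))
      (logistic (x + y * I)) y := by
    intro y
    have h0 : HasDerivAt (fun y : ℝ => (x + y * I : ℂ)) I y := by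
      simpa using ((Complex.ofRealCLM.hasDerivAt (x := y)).mul_const I).const_add (x : ℂ)
    have h1 := ((h0.cexp.const_add 1).clog_real (hs y)).const_mul (-I)
    refine h1.congr_deriv ?_
    have e1 := one_add_exp_neg_ne_zero (hne y)
    have e2 : 1 + Complex.exp (x + y * I) ≠ 0 := slitPlane_ne_zero (hs y)
    have e3 : Complex.exp (x + y * I) * Complex.exp (-(x + y * I)) = 1 := by
      rw [← Complex.exp_add, add_neg_cancel, Complex.exp_zero]
    rw [logistic]
    generalize (x : ℂ) + y * I = w at e1 e2 e3 ⊢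
    field_simp
    rw [Complex.I_sq]
    linear_combination e3
  have hc : Continuous fun y : ℝ => logistic (x + y * I) := by
    rw [continuous_iff_continuousAt]
    exact fun y => ContinuousAt.comp (f := fun y : ℝ => (x + y * I : ℂ))
      (differentiableAt_logistic (hne y)).continuousAt (by fun_prop)
  rw [lineMean, intervalIntegral.integral_eq_sub_of_hasDerivAt (fun y _ => hd y)
    (hc.intervalIntegrable _ _)]
  push_cast
  simp [Complex.exp_add]

lemma lineMean_logistic_of_pos {x : ℝ} (hx : 0 < x) : lineMean logistic x = 1 := by
  have hne : ∀ y : ℝ, Complex.exp (x + y * I) ≠ -1 := fun y =>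
    exp_ne_neg_one_of_re_ne_zero (by simpa using hx.ne')
  have h := lineMean_logistic_of_neg (neg_lt_zero.mpr hx)
  have hper : ∀ y : ℝ, logistic ((-x : ℝ) + (2 * π - y : ℝ) * I) = 1 - logistic (x + y * I) := by
    intro y
    rw [← logistic_neg (hne y), ← logistic_add_two_pi_I (-(x + y * I))]
    congr 1
    push_cast
    ring
  have hc : Continuous fun y : ℝ => logistic (x + y * I) := by
    rw [continuous_iff_continuousAt]
    exact fun y => ContinuousAt.comp (f := fun y : ℝ => (x + y * I : ℂ))
      (differentiableAt_logistic (hne y)).continuousAt (by fun_prop)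
  have hπ : (π : ℂ) ≠ 0 := by exact_mod_cast Real.pi_ne_zero
  rw [lineMean] at h ⊢
  have h2 := intervalIntegral.integral_comp_sub_left (a := 0) (b := 2 * π)
    (fun y : ℝ => logistic ((-x : ℝ) + y * I)) (2 * π)
  rw [sub_self, sub_zero] at h2
  rw [← h2] at h
  simp only [hper] at h
  rw [intervalIntegral.integral_sub (by simp) (hc.intervalIntegrable _ _)] at h
  have hne0 : ((2 * π)⁻¹ : ℝ) ≠ 0 := by positivity
  have h3 := (mul_eq_zero.mp h).resolve_left (by exact_mod_cast hne0)
  rw [← sub_eq_zero.mp h3]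
  simp
  field_simp

lemma lineMean_comp_sub (F : ℂ → ℂ) (c a : ℝ) :
    lineMean (fun z => F (z - c)) a = lineMean F (a - c) := by
  have e : ∀ y : ℝ, (a : ℂ) + y * I - c = (a - c : ℝ) + y * I := fun y => by
    push_cast
    ring
  simp only [lineMean, e]

lemma lineMean_eq_of_differentiableOn {F : ℂ → ℂ} {a b : ℝ}
    (hd : DifferentiableOn ℂ F (uIcc a b ×ℂ uIcc 0 (2 * π)))
    (hper : ∀ x : ℝ, F (x + 2 * π * I) = F x) : lineMean F a = lineMean F b := by
  have h := Complex.integral_boundary_rect_eq_zero_of_differentiableOn F a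
    ((b : ℂ) + (2 * π : ℝ) * I) (by simpa using hd)
  simp only [ofReal_re, ofReal_im, re_ofReal_add_ofReal_mul_I, add_im, mul_im, I_im, mul_one,
    I_re, mul_zero, add_zero, zero_add] at h
  have e : ∀ x : ℝ, F (x + (2 * π : ℝ) * I) = F (x + (0 : ℝ) * I) := fun x => by
    rw [ofReal_zero, zero_mul, add_zero, ← hper]
    push_cast
    rfl
  simp only [e, sub_self, zero_add, smul_eq_mul] at h
  rw [lineMean, lineMean]
  congr 1
  exact (mul_left_cancel₀ I_ne_zero (sub_eq_zero.mp h)).symm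

open Filter Topology in
/-- Crossing a simple pole changes the mean over a vertical line by the residue. -/
lemma lineMean_sub_lineMean {F : ℂ → ℂ} {a b c : ℝ} {r : ℂ} (hac : a < c) (hcb : c < b)
    (hd : ∀ z : ℂ, a ≤ z.re → z.re ≤ b → 0 ≤ z.im → z.im ≤ 2 * π → z ≠ c + π * I →
      DifferentiableAt ℂ F z)
    (hper : ∀ x : ℝ, F (x + 2 * π * I) = F x)
    (hr : Tendsto (fun z => (z - (c + π * I)) * F z) (𝓝[≠] (c + π * I)) (𝓝 r)) :
    lineMean F b - lineMean F a = r := by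
  have hπ := Real.pi_pos
  set p : ℂ := c + π * I with hp
  set G : ℂ → ℂ := fun z => F z - r * logistic (z - c) with hG
  set s : Set ℂ := uIcc a b ×ℂ uIcc 0 (2 * π) with hs
  have hmem : ∀ z, z ∈ s ↔ (a ≤ z.re ∧ z.re ≤ b) ∧ 0 ≤ z.im ∧ z.im ≤ 2 * π := by
    intro z
    rw [hs, Complex.mem_reProdIm, uIcc_of_le (by linarith), uIcc_of_le (by linarith)]
    rfl
  have hsp : s ∈ 𝓝 p := by
    rw [hs, uIcc_of_le (by linarith), uIcc_of_le (by linarith)]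
    refine mem_nhds_iff.mpr ⟨Ioo a b ×ℂ Ioo 0 (2 * π), ?_, isOpen_Ioo.reProdIm isOpen_Ioo, ?_⟩
    · exact reProdIm_subset_iff.mpr (prod_mono Ioo_subset_Icc_self Ioo_subset_Icc_self)
    · rw [Complex.mem_reProdIm]
      simp [hp, hac, hcb, hπ]
  have hl : ∀ z ∈ s, z ≠ p → Complex.exp (z - c) ≠ -1 := by
    intro z hz hzp h
    rw [hmem] at hz
    have := eq_pi_mul_I_of_exp_eq_neg_one h (by simpa using hz.2.1) (by simpa using hz.2.2)
    exact hzp (by rw [hp, ← this]; ring)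
  have hGd : DifferentiableOn ℂ G (s \ {p}) := by
    intro z hz
    have h1 := (hmem z).mp hz.1
    have h2 := hd z h1.1.1 h1.1.2 h1.2.1 h1.2.2 hz.2
    have h3 : DifferentiableAt ℂ (fun z => logistic (z - c)) z :=
      (differentiableAt_logistic (hl z hz.1 hz.2)).comp (f := fun z : ℂ => z - c) z (by fun_prop)
    exact (h2.sub (h3.const_mul r)).differentiableWithinAt
  have hlim : Tendsto (fun z => (z - p) * G z) (𝓝[≠] p) (𝓝 0) := by
    have h1 : Tendsto (fun z : ℂ => z - c) (𝓝[≠] p) (𝓝[≠] (π * I)) := by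
      refine tendsto_nhdsWithin_of_tendsto_nhds_of_eventually_within _ ?_ ?_
      · have : Tendsto (fun z : ℂ => z - c) (𝓝 p) (𝓝 (p - c)) := (by fun_prop : Continuous
          fun z : ℂ => z - c).tendsto p
        rw [show p - c = π * I by rw [hp]; ring] at this
        exact this.mono_left nhdsWithin_le_nhds
      · filter_upwards [self_mem_nhdsWithin] with z hz h
        exact hz (by rw [mem_singleton_iff, hp, ← mem_singleton_iff.mp h]; ring)
    have h2 := hr.sub ((tendsto_mul_logistic.comp h1).const_mul r)
    rw [mul_one, sub_self] at h2
    refine h2.congr fun z => ?_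
    simp only [Function.comp, hG, hp]
    ring
  have ho : (fun z => G z - G p) =o[𝓝[≠] p] fun z => (z - p)⁻¹ := by
    refine Asymptotics.isLittleO_of_tendsto' ?_ ?_
    · filter_upwards [self_mem_nhdsWithin] with z hz h
      exact absurd (sub_eq_zero.mp (inv_eq_zero.mp h)) hz
    · have h3 : Tendsto (fun z => (z - p) * G p) (𝓝[≠] p) (𝓝 0) := by
        have : Tendsto (fun z => (z - p) * G p) (𝓝 p) (𝓝 ((p - p) * G p)) :=
          (by fun_prop : Continuous fun z => (z - p) * G p).tendsto p
        rw [sub_self, zero_mul] at this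
        exact this.mono_left nhdsWithin_le_nhds
      have h4 := hlim.sub h3
      rw [sub_zero] at h4
      refine h4.congr fun z => ?_
      rw [div_inv_eq_mul]
      ring
  have hGd' := Complex.differentiableOn_update_limUnder_of_isLittleO hsp hGd ho
  set G' := Function.update G p (limUnder (𝓝[≠] p) G)
  have hG' : ∀ z, z.re ≠ c ∨ z.im ≠ π → G' z = G z := by
    intro z hz
    refine Function.update_of_ne ?_ _ _
    rintro rfl
    simp [hp] at hz
  have hper' : ∀ x : ℝ, G' (x + 2 * π * I) = G' x := by
    intro x
    rw [hG' _ (Or.inr (by simp)), hG' _ (Or.inr (by simpa using hπ.ne))]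
    simp only [hG]
    rw [hper, show (x : ℂ) + 2 * π * I - c = x - c + 2 * π * I by ring, logistic_add_two_pi_I]
  have hmean := lineMean_eq_of_differentiableOn hGd' hper'
  have hexp : ∀ x : ℝ, x ∈ Icc a b → x ≠ c →
      lineMean G' x = lineMean F x - r * lineMean logistic (x - c) := by
    intro x hx hxc
    rw [← lineMean_comp_sub, lineMean, lineMean, lineMean, mul_left_comm, ← mul_sub,
      ← intervalIntegral.integral_const_mul r, ← intervalIntegral.integral_sub]
    · congr 2
      ext y
      exact hG' _ (Or.inl (by simpa using hxc))
    · refine ContinuousOn.intervalIntegrable fun y hy => ?_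
      rw [uIcc_of_le (by linarith)] at hy
      have := hd (x + y * I) (by simpa using hx.1) (by simpa using hx.2) (by simpa using hy.1)
        (by simpa using hy.2) (fun h => hxc (by simpa [hp] using congrArg Complex.re h))
      exact (ContinuousAt.comp (f := fun y : ℝ => (x + y * I : ℂ)) this.continuousAt
        (by fun_prop)).continuousWithinAt
    · refine (Continuous.intervalIntegrable ?_ _ _).const_mul r
      rw [continuous_iff_continuousAt]
      intro y
      have := differentiableAt_logistic (z := x + y * I - c)
        (exp_ne_neg_one_of_re_ne_zero (by simpa [sub_eq_zero] using hxc))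
      exact ContinuousAt.comp (f := fun y : ℝ => (x + y * I - c : ℂ)) this.continuousAt
        (by fun_prop)
  rw [hexp a ⟨le_rfl, by linarith⟩ hac.ne, hexp b ⟨by linarith, le_rfl⟩ hcb.ne',
    lineMean_logistic_of_neg (by linarith), lineMean_logistic_of_pos (by linarith)] at hmean
  linear_combination -hmean

/-- The weight selecting one sector of winding angle. -/
def cellWeight (L : ℝ) (z : ℂ) : ℂ := logistic (z - 2 * L) - logistic (z - 3 * L)

lemma cellWeight_add_two_pi_I (L : ℝ) (z : ℂ) :
    cellWeight L (z + 2 * π * I) = cellWeight L z := by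
  rw [cellWeight, cellWeight, add_sub_right_comm, logistic_add_two_pi_I, add_sub_right_comm,
    logistic_add_two_pi_I]

lemma half_odd_mul_ne_zero {L : ℝ} (hL : 0 < L) (n : ℤ) : ((n : ℝ) + 1 / 2) * L ≠ 0 := by
  refine mul_ne_zero (fun h => ?_) hL.ne'
  have h2 : (2 * n + 1 : ℝ) = 0 := by linarith
  have h3 : 2 * n + 1 = 0 := by exact_mod_cast h2
  omega

lemma half_mul_le_abs_half_odd_mul {L : ℝ} (hL : 0 < L) (n : ℤ) :
    L / 2 ≤ |((n : ℝ) + 1 / 2) * L| := by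
  rw [abs_mul, abs_of_pos hL]
  have : (1 / 2 : ℝ) ≤ |(n : ℝ) + 1 / 2| := by
    rcases le_or_gt 0 n with h | h
    · have : (0 : ℝ) ≤ n := by exact_mod_cast h
      exact le_abs.mpr (Or.inl (by linarith))
    · have : (n : ℝ) ≤ -1 := by exact_mod_cast (by omega : n ≤ -1)
      exact le_abs.mpr (Or.inr (by linarith))
  nlinarith

lemma norm_logistic_le {δ : ℝ} (hδ : 0 < δ) {z : ℂ} (hz : δ ≤ |z.re|) :
    ‖logistic z‖ ≤ (1 - Real.exp (-δ))⁻¹ := by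
  have h1 : 0 < 1 - Real.exp (-δ) := by
    rw [sub_pos, Real.exp_lt_one_iff]
    linarith
  rw [logistic, norm_inv]
  refine inv_anti₀ h1 ?_
  have h2 := abs_norm_sub_norm_le (1 : ℂ) (-Complex.exp (-z))
  rw [norm_neg, Complex.norm_exp, neg_re, norm_one, sub_neg_eq_add] at h2
  refine le_trans ?_ h2
  rcases le_abs.mp hz with h | h
  · refine le_trans ?_ (le_abs_self _)
    have := Real.exp_le_exp.mpr (neg_le_neg h)
    linarith
  · refine le_trans ?_ (neg_le_abs _)
    have h3 := Real.add_one_le_exp (-z.re)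
    have h4 := Real.exp_le_exp.mpr (show -δ ≤ 0 by linarith)
    have h5 := Real.exp_le_exp.mpr h
    have h6 : Real.exp δ * Real.exp (-δ) = 1 := by
      rw [← Real.exp_add, add_neg_cancel, Real.exp_zero]
    have h7 : 1 ≤ Real.exp δ := Real.one_le_exp hδ.le
    nlinarith

lemma re_line_sub (L : ℝ) (m k : ℤ) (y : ℝ) :
    ((5 / 2 * L : ℝ) + y * I + m * L - k * L : ℂ).re = (((2 + m - k : ℤ) : ℝ) + 1 / 2) * L := by
  simp
  ring

lemma differentiableAt_logistic_sub {z : ℂ} {c : ℂ} (h : Complex.exp (z - c) ≠ -1) :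
    DifferentiableAt ℂ (fun z => logistic (z - c)) z :=
  (differentiableAt_logistic h).comp (f := fun z : ℂ => z - c) z (by fun_prop)

lemma differentiableAt_cellWeight_add {L : ℝ} {z c : ℂ} (h2 : Complex.exp (z + c - 2 * L) ≠ -1)
    (h3 : Complex.exp (z + c - 3 * L) ≠ -1) :
    DifferentiableAt ℂ (fun z => cellWeight L (z + c)) z := by
  have e2 := differentiableAt_logistic_sub (z := z) (c := 2 * L - c) (by convert h2 using 2; ring)
  have e3 := differentiableAt_logistic_sub (z := z) (c := 3 * L - c) (by convert h3 using 2; ring)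
  refine (e2.sub e3).congr_of_eventuallyEq (Filter.Eventually.of_forall fun w => ?_)
  simp only [cellWeight, Pi.sub_apply]
  congr 2 <;> ring

/-- The mean along the critical line encoding all walks that start from one state. -/
def walkMean (L : ℝ) (m : ℤ) (x y : ℕ) : ℂ :=
  lineMean (fun z => thetaQuot L z ^ x * thetaQuot L (z - L) ^ y * cellWeight L (z + m * L))
    (5 / 2 * L)

lemma continuous_walkMean_integrand {L : ℝ} (hL : 0 < L) (m : ℤ) (x y : ℕ) :
    Continuous fun s : ℝ => thetaQuot L ((5 / 2 * L : ℝ) + s * I) ^ x *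
      thetaQuot L ((5 / 2 * L : ℝ) + s * I - L) ^ y *
      cellWeight L ((5 / 2 * L : ℝ) + s * I + m * L) := by
  rw [continuous_iff_continuousAt]
  intro s
  have hre := re_ofReal_add_ofReal_mul_I (5 / 2 * L) s
  have hX := differentiableAt_thetaQuot_of_lt hL (z := (5 / 2 * L : ℝ) + s * I) (by linarith)
    (by linarith)
  have hY := differentiableAt_thetaQuot_of_lt hL (z := (5 / 2 * L : ℝ) + s * I - L)
    (by rw [sub_re, hre, ofReal_re]; linarith) (by rw [sub_re, hre, ofReal_re]; linarith)
  have hW := differentiableAt_cellWeight_add (L := L) (z := (5 / 2 * L : ℝ) + s * I) (c := m * L)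
    (exp_ne_neg_one_of_re_ne_zero (by
      have h := half_odd_mul_ne_zero hL (2 + m - 2)
      rw [← re_line_sub L m 2 s] at h
      push_cast at h ⊢
      exact h))
    (exp_ne_neg_one_of_re_ne_zero (by
      have h := half_odd_mul_ne_zero hL (2 + m - 3)
      rw [← re_line_sub L m 3 s] at h
      push_cast at h ⊢
      exact h))
  have c1 := ContinuousAt.comp (f := fun s : ℝ => ((5 / 2 * L : ℝ) + s * I : ℂ)) (x := s)
    hX.continuousAt (by fun_prop)
  have c2 := ContinuousAt.comp (f := fun s : ℝ => ((5 / 2 * L : ℝ) + s * I - L : ℂ)) (x := s)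
    hY.continuousAt (by fun_prop)
  have c3 := ContinuousAt.comp (f := fun s : ℝ => ((5 / 2 * L : ℝ) + s * I : ℂ)) (x := s)
    hW.continuousAt (by fun_prop)
  exact ((c1.pow x).mul (c2.pow y)).mul c3

lemma lineMean_congr {F G : ℂ → ℂ} {a : ℝ} (h : ∀ y : ℝ, F (a + y * I) = G (a + y * I)) :
    lineMean F a = lineMean G a := by
  simp only [lineMean, h]

lemma lineMean_add {F G : ℂ → ℂ} {a : ℝ} (hF : Continuous fun y : ℝ => F (a + y * I))
    (hG : Continuous fun y : ℝ => G (a + y * I)) :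
    lineMean (fun z => F z + G z) a = lineMean F a + lineMean G a := by
  rw [lineMean, lineMean, lineMean, ← mul_add, intervalIntegral.integral_add
    (hF.intervalIntegrable _ _) (hG.intervalIntegrable _ _)]

lemma lineMean_const_mul (F : ℂ → ℂ) (a : ℝ) (c : ℂ) :
    lineMean (fun z => c * F z) a = c * lineMean F a := by
  rw [lineMean, lineMean, intervalIntegral.integral_const_mul, mul_left_comm]

lemma norm_lineMean_le {F : ℂ → ℂ} {a C : ℝ} (h : ∀ y : ℝ, ‖F (a + y * I)‖ ≤ C) :
    ‖lineMean F a‖ ≤ C := by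
  have hπ := Real.pi_pos
  have h1 := intervalIntegral.norm_integral_le_of_norm_le_const (a := 0) (b := 2 * π)
    (f := fun y : ℝ => F (a + y * I)) (C := C) (fun y _ => h y)
  rw [sub_zero, abs_of_pos (by positivity)] at h1
  rw [lineMean, norm_mul, Complex.norm_real, Real.norm_of_nonneg (by positivity)]
  calc (2 * π)⁻¹ * _ ≤ (2 * π)⁻¹ * (C * (2 * π)) := by gcongr
    _ = C := by field_simp

lemma norm_cellWeight_le {L : ℝ} (hL : 0 < L) (m : ℤ) (y : ℝ) :
    ‖cellWeight L ((5 / 2 * L : ℝ) + y * I + m * L)‖ ≤ 2 * (1 - Real.exp (-(L / 2)))⁻¹ := by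
  have h2 := re_line_sub L m 2 y
  have h3 := re_line_sub L m 3 y
  have a2 := norm_logistic_le (half_pos hL) (h2 ▸ half_mul_le_abs_half_odd_mul hL (2 + m - 2))
  have a3 := norm_logistic_le (half_pos hL) (h3 ▸ half_mul_le_abs_half_odd_mul hL (2 + m - 3))
  push_cast at a2 a3 ⊢
  rw [cellWeight, two_mul (1 - Real.exp (-(L / 2)))⁻¹]
  refine (norm_sub_le _ _).trans (add_le_add ?_ ?_)
  · exact a2
  · exact a3

lemma norm_walkMean_le {L t : ℝ} (hL : 0 < L) (ht0 : 0 < t) (ht1 : t < 1 / 4)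
    (ht : 4 * (t : ℂ) * thetaInt L 0 ^ 2 = thetaHalf L 0 ^ 2) (m : ℤ) (x y : ℕ) :
    ‖walkMean L m x y‖ ≤ 2 * (1 - Real.exp (-(L / 2)))⁻¹ := by
  refine norm_lineMean_le fun s => ?_
  have hn := (norm_thetaQuot_lt_one hL ht0 ht1 ht s).le
  rw [thetaQuot_sub_eq_conj, norm_mul, norm_mul, norm_pow, norm_pow, RCLike.norm_conj]
  refine le_trans ?_ (norm_cellWeight_le hL m s)
  refine mul_le_of_le_one_left (norm_nonneg _) ?_
  exact mul_le_one₀ (pow_le_one₀ (norm_nonneg _) hn) (by positivity)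
    (pow_le_one₀ (norm_nonneg _) hn)

lemma walkMean_zero_zero {L : ℝ} (hL : 0 < L) (m : ℤ) :
    walkMean L m 0 0 = if m = 0 then 1 else 0 := by
  have hsign : ∀ k : ℤ, lineMean logistic (((k : ℝ) + 1 / 2) * L) = if 0 ≤ k then 1 else 0 := by
    intro k
    split_ifs with h
    · have : (0 : ℝ) ≤ k := by exact_mod_cast h
      exact lineMean_logistic_of_pos (by positivity)
    · have : (k : ℝ) ≤ -1 := by exact_mod_cast (by omega : k ≤ -1)
      exact lineMean_logistic_of_neg (mul_neg_of_neg_of_pos (by linarith) hL)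
  have hcont : ∀ k : ℤ, Continuous fun y : ℝ =>
      logistic ((5 / 2 * L : ℝ) + y * I - (((2 - k : ℝ) * L : ℝ) : ℂ)) := by
    intro k
    rw [continuous_iff_continuousAt]
    intro y
    have := differentiableAt_logistic (z := (5 / 2 * L : ℝ) + y * I - (((2 - k : ℝ) * L : ℝ) : ℂ))
      (exp_ne_neg_one_of_re_ne_zero (by
        rw [sub_re, re_ofReal_add_ofReal_mul_I, ofReal_re]
        convert half_odd_mul_ne_zero hL k using 1
        ring))
    exact ContinuousAt.comp (f := fun y : ℝ =>
      ((5 / 2 * L : ℝ) + y * I - (((2 - k : ℝ) * L : ℝ) : ℂ) : ℂ)) this.continuousAt (by fun_prop)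
  have e : walkMean L m 0 0 = lineMean (fun z => logistic (z - (((2 - m : ℝ) * L : ℝ) : ℂ)) +
      -1 * logistic (z - (((2 - (m - 1 : ℤ) : ℝ) * L : ℝ) : ℂ))) (5 / 2 * L) := by
    refine lineMean_congr fun y => ?_
    rw [pow_zero, pow_zero, one_mul, one_mul, cellWeight, neg_one_mul, ← sub_eq_add_neg]
    push_cast
    congr 2 <;> ring
  rw [e, lineMean_add (hcont m) ((hcont (m - 1)).const_mul (-1)), lineMean_const_mul,
    lineMean_comp_sub, lineMean_comp_sub, show 5 / 2 * L - (2 - m) * L = (m + 1 / 2) * L by ring,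
    show 5 / 2 * L - (2 - (m - 1 : ℤ)) * L = ((m - 1 : ℤ) + 1 / 2) * L by ring, hsign, hsign]
  split_ifs <;> first | omega | norm_num

lemma walkMean_succ_succ {L t : ℝ} (hL : 0 < L)
    (ht : 4 * (t : ℂ) * thetaInt L 0 ^ 2 = thetaHalf L 0 ^ 2) (m : ℤ) (x y : ℕ) :
    walkMean L m (x + 1) (y + 1) = t * (walkMean L m (x + 2) (y + 2) + walkMean L m (x + 2) y +
      walkMean L m x (y + 2) + walkMean L m x y) := by
  have c := continuous_walkMean_integrand hL m
  rw [walkMean, walkMean, walkMean, walkMean, walkMean, ← lineMean_add (c _ _) (c _ _),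
    ← lineMean_add ((c _ _).add (c _ _)) (c _ _),
    ← lineMean_add (((c _ _).add (c _ _)).add (c _ _)) (c _ _), ← lineMean_const_mul]
  refine lineMean_congr fun s => ?_
  have hre := re_ofReal_add_ofReal_mul_I (5 / 2 * L) s
  have hk := thetaQuot_mul_thetaQuot_sub hL ht (z := (5 / 2 * L : ℝ) + s * I)
    (thetaHalf_ne_zero (by positivity) (by linarith) (by linarith))
    (thetaHalf_ne_zero (by positivity) (by simp only [sub_re, ofReal_re]; linarith)
      (by simp only [sub_re, ofReal_re]; linarith))
  linear_combination (thetaQuot L ((5 / 2 * L : ℝ) + s * I) ^ x *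
      thetaQuot L ((5 / 2 * L : ℝ) + s * I - L) ^ y *
      cellWeight L ((5 / 2 * L : ℝ) + s * I + m * L)) * hk

lemma exp_sub_int_mul_ne_neg_one {L : ℝ} (hL : 0 < L) {n : ℤ} {z : ℂ}
    (h1 : (n - 1 / 2) * L ≤ z.re) (h2 : z.re ≤ (n + 1 / 2) * L) (h3 : 0 ≤ z.im)
    (h4 : z.im ≤ 2 * π) (h : z ≠ n * L + π * I) (k : ℤ) : Complex.exp (z - k * L) ≠ -1 := by
  intro he
  have := eq_pi_mul_I_of_exp_eq_neg_one he (by simpa using h3) (by simpa using h4)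
  have hz : z = k * L + π * I := by rw [← this]; ring
  have hre : z.re = k * L := by rw [hz]; simp
  rw [hre] at h1 h2
  have a1 := le_of_mul_le_mul_right h1 hL
  have a2 := le_of_mul_le_mul_right h2 hL
  have b1 : n < k + 1 := by
    have : (n : ℝ) < k + 1 := by linarith
    exact_mod_cast this
  have b2 : k < n + 1 := by
    have : (k : ℝ) < n + 1 := by linarith
    exact_mod_cast this
  have : k = n := by omega
  exact h (this ▸ hz)

open Filter Topology in
lemma exists_tendsto_mul_logistic_sub {L : ℝ} (hL : 0 < L) (n k : ℤ) :
    ∃ s, Tendsto (fun z => (z - (n * L + π * I)) * logistic (z - k * L))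
      (𝓝[≠] ((n : ℂ) * L + π * I)) (𝓝 s) := by
  rcases eq_or_ne k n with rfl | hk
  · refine ⟨1, ?_⟩
    have h1 : Tendsto (fun z : ℂ => z - k * L) (𝓝[≠] ((k : ℂ) * L + π * I)) (𝓝[≠] (π * I)) := by
      refine tendsto_nhdsWithin_of_tendsto_nhds_of_eventually_within _ ?_ ?_
      · have : Tendsto (fun z : ℂ => z - k * L) (𝓝 ((k : ℂ) * L + π * I))
            (𝓝 ((k : ℂ) * L + π * I - k * L)) :=
          (by fun_prop : Continuous fun z : ℂ => z - k * L).tendsto _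
        rw [add_sub_cancel_left] at this
        exact this.mono_left nhdsWithin_le_nhds
      · filter_upwards [self_mem_nhdsWithin] with z hz h
        exact hz (by rw [mem_singleton_iff, ← mem_singleton_iff.mp h]; ring)
    refine (tendsto_mul_logistic.comp h1).congr fun z => ?_
    simp only [Function.comp]
    ring
  · have hd := differentiableAt_logistic_sub (z := n * L + π * I) (c := k * L)
      (exp_ne_neg_one_of_re_ne_zero (by
        have : ((n : ℝ) - k) * L ≠ 0 :=
          mul_ne_zero (sub_ne_zero.mpr (by exact_mod_cast hk.symm)) hL.ne'
        simpa [sub_mul] using this))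
    exact ⟨_, ((continuous_id.sub continuous_const).continuousAt.mul
      hd.continuousAt).tendsto.mono_left nhdsWithin_le_nhds⟩

open Filter Topology in
lemma exists_tendsto_mul_cellWeight {L : ℝ} (hL : 0 < L) (n m : ℤ) :
    ∃ s, Tendsto (fun z => (z - (n * L + π * I)) * cellWeight L (z + m * L))
      (𝓝[≠] ((n : ℂ) * L + π * I)) (𝓝 s) := by
  obtain ⟨s1, h1⟩ := exists_tendsto_mul_logistic_sub hL n (2 - m)
  obtain ⟨s2, h2⟩ := exists_tendsto_mul_logistic_sub hL n (3 - m)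
  refine ⟨s1 - s2, (h1.sub h2).congr fun z => ?_⟩
  rw [← mul_sub, cellWeight]
  push_cast
  congr 3 <;> ring

lemma differentiableAt_cellWeight_of_forall {L : ℝ} {z : ℂ}
    (h : ∀ k : ℤ, Complex.exp (z - k * L) ≠ -1) (m : ℤ) :
    DifferentiableAt ℂ (fun z => cellWeight L (z + m * L)) z := by
  refine differentiableAt_cellWeight_add ?_ ?_
  · convert h (2 - m) using 2
    push_cast
    ring
  · convert h (3 - m) using 2
    push_cast
    ring

open Filter Topology in
/-- Moving the line of integration across a zero of the integrand. -/
lemma lineMean_mul_cellWeight_shift {L : ℝ} (hL : 0 < L) {M : ℂ → ℂ} (n m : ℤ)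
    (hM : ∀ z : ℂ, (n - 1 / 2) * L ≤ z.re → z.re ≤ (n + 1 / 2) * L → DifferentiableAt ℂ M z)
    (hper : ∀ z, M (z + 2 * π * I) = M z) (h0 : M (n * L + π * I) = 0) :
    lineMean (fun z => M z * cellWeight L (z + m * L)) ((n - 1 / 2) * L) =
      lineMean (fun z => M z * cellWeight L (z + m * L)) ((n + 1 / 2) * L) := by
  have e : (((n * L : ℝ) : ℂ)) = n * L := by push_cast; rfl
  refine (sub_eq_zero.mp (lineMean_sub_lineMean (c := n * L) (by linarith) (by linarith)
    (fun z h1 h2 h3 h4 h5 => ?_) (fun x => ?_) ?_)).symm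
  · rw [e] at h5
    exact (hM z h1 h2).mul (differentiableAt_cellWeight_of_forall
      (exp_sub_int_mul_ne_neg_one hL h1 h2 h3 h4 h5) m)
  · simp only [hper]
    rw [add_right_comm, cellWeight_add_two_pi_I]
  · rw [e]
    obtain ⟨s, hs⟩ := exists_tendsto_mul_cellWeight hL n m
    have h1 := (hM (n * L + π * I) (by simp; linarith)
      (by simp; linarith)).continuousAt.tendsto.mono_left
      (nhdsWithin_le_nhds (s := {(n * L + π * I : ℂ)}ᶜ))
    rw [h0] at h1
    have h2 := h1.mul hs
    rw [zero_mul] at h2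
    refine h2.congr fun z => ?_
    ring

lemma thetaQuot_pow_add_two_pi_I (L : ℝ) (z : ℂ) {x : ℕ} (hx : Even x) :
    thetaQuot L (z + 2 * π * I) ^ x = thetaQuot L z ^ x := by
  rw [thetaQuot_add_two_pi_I, hx.neg_pow]

lemma walkMean_zero_left {L : ℝ} (hL : 0 < L) (m : ℤ) {y : ℕ} (hy : Even y) (hy0 : y ≠ 0) :
    walkMean L m 0 y = walkMean L (m + 1) y 0 := by
  have h := lineMean_mul_cellWeight_shift hL (M := fun z => thetaQuot L z ^ y) 2 (m + 1)
    (fun z h1 h2 => (differentiableAt_thetaQuot_of_lt hL (by push_cast at h1; linarith)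
      (by push_cast at h2; linarith)).pow y) (fun z => thetaQuot_pow_add_two_pi_I L z hy)
    (by
      have := thetaQuot_two_mul_add_pi_mul_I L
      push_cast
      rw [this, zero_pow hy0])
  rw [walkMean, walkMean]
  rw [show ((2 : ℤ) - 1 / 2 : ℝ) * L = 5 / 2 * L - L by push_cast; ring,
    show ((2 : ℤ) + 1 / 2 : ℝ) * L = 5 / 2 * L by push_cast; ring, ← lineMean_comp_sub] at h
  simp only [pow_zero, mul_one, one_mul]
  rw [← h]
  refine lineMean_congr fun s => ?_
  congr 2
  push_cast
  ring

lemma lineMean_thetaQuot_add_mul {L : ℝ} (hL : 0 < L) (m : ℤ) {x : ℕ} (hx : Odd x) :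
    lineMean (fun z => thetaQuot L (z + L) * thetaQuot L z ^ x * cellWeight L (z + m * L))
      (5 / 2 * L) = walkMean L (m - 1) 1 x := by
  have h := lineMean_mul_cellWeight_shift hL
    (M := fun z => thetaQuot L (z + L) * thetaQuot L z ^ x) 2 m
    (fun z h1 h2 => by
      push_cast at h1 h2
      have d1 := (differentiableAt_thetaQuot_of_lt hL (z := z + L)
        (by rw [add_re, ofReal_re]; linarith) (by rw [add_re, ofReal_re]; linarith)).comp
        (f := fun z : ℂ => z + L) z (by fun_prop)
      exact d1.mul ((differentiableAt_thetaQuot_of_lt hL (by linarith) (by linarith)).pow x))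
    (fun z => by
      rw [add_right_comm, thetaQuot_add_two_pi_I, thetaQuot_add_two_pi_I, hx.neg_pow]
      ring)
    (by
      have := thetaQuot_two_mul_add_pi_mul_I L
      push_cast
      rw [this, zero_pow hx.pos.ne', mul_zero])
  rw [show ((2 : ℤ) - 1 / 2 : ℝ) * L = 5 / 2 * L - L by push_cast; ring,
    show ((2 : ℤ) + 1 / 2 : ℝ) * L = 5 / 2 * L by push_cast; ring, ← lineMean_comp_sub] at h
  rw [← h, walkMean]
  refine lineMean_congr fun s => ?_
  rw [sub_add_cancel, pow_one]
  congr 2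
  push_cast
  ring

lemma walkMean_add_two_zero {L t : ℝ} (hL : 0 < L)
    (ht : 4 * (t : ℂ) * thetaInt L 0 ^ 2 = thetaHalf L 0 ^ 2) (m : ℤ) {x : ℕ} (hx : Even x) :
    walkMean L m (x + 2) 0 = t * (walkMean L m (x + 3) 1 + walkMean L m (x + 1) 1 +
      walkMean L (m - 1) 1 (x + 3) + walkMean L (m - 1) 1 (x + 1)) := by
  have c := continuous_walkMean_integrand hL m
  have c' : ∀ k : ℕ, Continuous fun s : ℝ => thetaQuot L ((5 / 2 * L : ℝ) + s * I + L) *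
      thetaQuot L ((5 / 2 * L : ℝ) + s * I) ^ k *
      cellWeight L ((5 / 2 * L : ℝ) + s * I + m * L) := by
    intro k
    have h1 : Continuous fun s : ℝ => thetaQuot L ((5 / 2 * L : ℝ) + s * I + L) := by
      rw [continuous_iff_continuousAt]
      intro s
      have := differentiableAt_thetaQuot_of_lt hL (z := (5 / 2 * L : ℝ) + s * I + L)
        (by rw [add_re _ (L : ℂ), re_ofReal_add_ofReal_mul_I, ofReal_re]; linarith)
        (by rw [add_re _ (L : ℂ), re_ofReal_add_ofReal_mul_I, ofReal_re]; linarith)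
      exact ContinuousAt.comp (f := fun s : ℝ => ((5 / 2 * L : ℝ) + s * I + L : ℂ))
        this.continuousAt (by fun_prop)
    refine (h1.mul (c k 0)).congr fun s => ?_
    simp only [Pi.mul_apply]
    ring
  have hx1 : Odd (x + 1) := hx.add_one
  have hx3 : Odd (x + 3) := by
    rw [show x + 3 = (x + 2) + 1 by ring]
    exact (hx.add even_two).add_one
  rw [← lineMean_thetaQuot_add_mul hL m hx1, ← lineMean_thetaQuot_add_mul hL m hx3, walkMean,
    walkMean, walkMean, ← lineMean_add (c _ _) (c _ _),
    ← lineMean_add ((c _ _).add (c _ _)) (c' _),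
    ← lineMean_add (((c _ _).add (c _ _)).add (c' _)) (c' _), ← lineMean_const_mul]
  refine lineMean_congr fun s => ?_
  have hre := re_ofReal_add_ofReal_mul_I (5 / 2 * L) s
  have hk := thetaQuot_eq hL ht (z := (5 / 2 * L : ℝ) + s * I) (by linarith) (by linarith)
  linear_combination (thetaQuot L ((5 / 2 * L : ℝ) + s * I) ^ (x + 1) *
      cellWeight L ((5 / 2 * L : ℝ) + s * I + m * L)) * hk

lemma cellWeight_five_mul_sub {L : ℝ} {z : ℂ} (h2 : Complex.exp (z - 2 * L) ≠ -1)
    (h3 : Complex.exp (z - 3 * L) ≠ -1) : cellWeight L (5 * L - z) = cellWeight L z := by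
  rw [cellWeight, cellWeight, show 5 * (L : ℂ) - z - 2 * L = -(z - 3 * L) by ring,
    show 5 * (L : ℂ) - z - 3 * L = -(z - 2 * L) by ring, logistic_neg h2, logistic_neg h3]
  ring

lemma walkMean_neg {L : ℝ} (hL : 0 < L) (m : ℤ) : walkMean L (-m) 1 1 = walkMean L m 1 1 := by
  rw [walkMean, walkMean, lineMean, lineMean]
  congr 1
  have h := intervalIntegral.integral_comp_sub_left (a := 0) (b := 2 * π)
    (fun s : ℝ => thetaQuot L ((5 / 2 * L : ℝ) + s * I) ^ 1 *
      thetaQuot L ((5 / 2 * L : ℝ) + s * I - L) ^ 1 *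
      cellWeight L ((5 / 2 * L : ℝ) + s * I + (-m : ℤ) * L)) (2 * π)
  rw [sub_self, sub_zero] at h
  rw [← h]
  congr 1
  ext s
  have hW := cellWeight_five_mul_sub (L := L) (z := (5 / 2 * L : ℝ) + s * I + m * L)
    (exp_ne_neg_one_of_re_ne_zero (by
      have h := half_odd_mul_ne_zero hL (2 + m - 2)
      rw [← re_line_sub L m 2 s] at h
      push_cast at h ⊢
      exact h))
    (exp_ne_neg_one_of_re_ne_zero (by
      have h := half_odd_mul_ne_zero hL (2 + m - 3)
      rw [← re_line_sub L m 3 s] at h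
      push_cast at h ⊢
      exact h))
  have e1 : ((5 / 2 * L : ℝ) + (2 * π - s : ℝ) * I : ℂ) =
      4 * L - ((5 / 2 * L : ℝ) + s * I - L) + 2 * π * I := by push_cast; ring
  have e2 : ((5 / 2 * L : ℝ) + (2 * π - s : ℝ) * I - L : ℂ) =
      4 * L - ((5 / 2 * L : ℝ) + s * I) + 2 * π * I := by push_cast; ring
  have e3 : ((5 / 2 * L : ℝ) + (2 * π - s : ℝ) * I + (-m : ℤ) * L : ℂ) =
      5 * L - ((5 / 2 * L : ℝ) + s * I + m * L) + 2 * π * I := by push_cast; ring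
  rw [e2, e3, e1, thetaQuot_add_two_pi_I, thetaQuot_add_two_pi_I, thetaQuot_four_mul_sub,
    thetaQuot_four_mul_sub, cellWeight_add_two_pi_I, hW]
  ring

open Filter Topology in
/-- Moving the line of integration across a pole of the integrand. -/
lemma lineMean_mul_cellWeight_sub {L : ℝ} (hL : 0 < L) {M : ℂ → ℂ} (n m : ℤ) {r : ℂ}
    (hM : ∀ z : ℂ, (n - 1 / 2) * L ≤ z.re → z.re ≤ (n + 1 / 2) * L →
      (∀ k : ℤ, Complex.exp (z - k * L) ≠ -1) → DifferentiableAt ℂ M z)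
    (hper : ∀ z, M (z + 2 * π * I) = M z)
    (hr : Tendsto (fun z => (z - (n * L + π * I)) * (M z * cellWeight L (z + m * L)))
      (𝓝[≠] ((n : ℂ) * L + π * I)) (𝓝 r)) :
    lineMean (fun z => M z * cellWeight L (z + m * L)) ((n + 1 / 2) * L) -
      lineMean (fun z => M z * cellWeight L (z + m * L)) ((n - 1 / 2) * L) = r := by
  have e : (((n * L : ℝ) : ℂ)) = n * L := by push_cast; rfl
  refine lineMean_sub_lineMean (c := n * L) (by linarith) (by linarith)
    (fun z h1 h2 h3 h4 h5 => ?_) (fun x => ?_) ?_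
  · rw [e] at h5
    have h6 := exp_sub_int_mul_ne_neg_one hL h1 h2 h3 h4 h5
    exact (hM z h1 h2 h6).mul (differentiableAt_cellWeight_of_forall h6 m)
  · simp only [hper]
    rw [add_right_comm, cellWeight_add_two_pi_I]
  · rw [e]
    exact hr

lemma thetaQuot_add_pi_mul_I {L : ℝ} (hL : 0 < L) : thetaQuot L (L + π * I) = -I := by
  have h0 : thetaInt (2 * L) (L + π * I) ≠ 0 :=
    thetaInt_ne_zero (by positivity) (by simp [abs_of_pos hL]; linarith)
  have h1 : thetaInt (2 * L) (L + π * I - (2 * L : ℝ)) = thetaInt (2 * L) (L + π * I) := by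
    rw [← thetaInt_neg, ← thetaInt_add_two_pi_I]
    congr 1
    push_cast
    ring
  have h2 : Complex.exp (-(2 * L : ℝ) / 4 + (L + π * I) / 2) = I := by
    rw [show -((2 * L : ℝ) : ℂ) / 4 + (L + π * I) / 2 = π / 2 * I by push_cast; ring,
      Complex.exp_pi_div_two_mul_I]
  rw [thetaQuot, thetaHalf_eq, h1, h2]
  field_simp
  rw [I_sq]
  ring

lemma thetaQuot_three_mul_add_pi_mul_I {L : ℝ} (hL : 0 < L) :
    thetaQuot L (3 * L + π * I) = I := by
  have h := thetaQuot_sub_two_mul L (3 * L + π * I)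
  rw [show 3 * (L : ℂ) + π * I - 2 * L = L + π * I by ring, thetaQuot_add_pi_mul_I hL] at h
  rw [← inv_inv (thetaQuot L _), ← h]
  simp

open Filter Topology in
lemma tendsto_sub_const_punctured (a c : ℂ) :
    Tendsto (fun z : ℂ => z - c) (𝓝[≠] (c + a)) (𝓝[≠] a) := by
  refine tendsto_nhdsWithin_of_tendsto_nhds_of_eventually_within _ ?_ ?_
  · have : Tendsto (fun z : ℂ => z - c) (𝓝 (c + a)) (𝓝 (c + a - c)) :=
      (by fun_prop : Continuous fun z : ℂ => z - c).tendsto _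
    rw [add_sub_cancel_left] at this
    exact this.mono_left nhdsWithin_le_nhds
  · filter_upwards [self_mem_nhdsWithin] with z hz h
    exact hz (by rw [mem_singleton_iff, ← mem_singleton_iff.mp h]; ring)

open Filter Topology in
lemma tendsto_mul_thetaQuot {L : ℝ} (hL : 0 < L) :
    Tendsto (fun z => (z - (4 * L + π * I)) * thetaQuot L z) (𝓝[≠] (4 * L + π * I))
      (𝓝 (4 / (I * thetaHalf L 0 ^ 2))) := by
  have h2L : 0 < 2 * L := by positivity
  have hd := hasDerivAt_iff_tendsto_slope.mp (differentiable_thetaHalf h2L (π * I)).hasDerivAt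
  rw [deriv_thetaHalf_pi_mul_I hL] at hd
  have hT := (differentiable_thetaInt h2L (π * I)).continuousAt.tendsto.mono_left
    (nhdsWithin_le_nhds (s := {(π * I : ℂ)}ᶜ))
  have n1 := thetaInt_pi_mul_I_ne_zero h2L
  have n2 := thetaHalf_zero_ne_zero hL
  have h := (hT.div hd (mul_ne_zero (by simp) (mul_ne_zero n1 (pow_ne_zero 2 n2)))).comp
    (tendsto_sub_const_punctured (π * I) (4 * L))
  have e : thetaInt (2 * L) (π * I) / (I / 4 * (thetaInt (2 * L) (π * I) * thetaHalf L 0 ^ 2)) =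
      4 / (I * thetaHalf L 0 ^ 2) := by
    field_simp
  rw [e] at h
  refine h.congr fun z => ?_
  simp only [Function.comp, Pi.div_apply, slope_def_field, thetaHalf_pi_mul_I, sub_zero]
  rw [← thetaQuot_sub_four_mul, thetaQuot, div_div_eq_mul_div]
  ring

lemma cellWeight_ofReal_add_pi_mul_I (L x : ℝ) : cellWeight L (x + π * I) =
    ((1 - Real.exp (-(x - 2 * L)))⁻¹ - (1 - Real.exp (-(x - 3 * L)))⁻¹ : ℝ) := by
  rw [ofReal_sub, ← logistic_ofReal_add_pi_mul_I, ← logistic_ofReal_add_pi_mul_I, cellWeight]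
  push_cast
  congr 2 <;> ring

open Filter Topology in
lemma tendsto_cellWeight_add {L : ℝ} (n j : ℤ) (h2 : (n + j - 2) * L ≠ 0)
    (h3 : (n + j - 3) * L ≠ 0) :
    Tendsto (fun z => cellWeight L (z + j * L)) (𝓝[≠] ((n : ℂ) * L + π * I))
      (𝓝 (((1 - Real.exp (-((n + j - 2) * L)))⁻¹ -
        (1 - Real.exp (-((n + j - 3) * L)))⁻¹ : ℝ))) := by
  have hd := differentiableAt_cellWeight_add (L := L) (z := n * L + π * I) (c := j * L)
    (exp_ne_neg_one_of_re_ne_zero (by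
      convert h2 using 1
      simp
      ring))
    (exp_ne_neg_one_of_re_ne_zero (by
      convert h3 using 1
      simp
      ring))
  have h := hd.continuousAt.tendsto.mono_left
    (nhdsWithin_le_nhds (s := {((n : ℂ) * L + π * I : ℂ)}ᶜ))
  convert h using 2
  rw [show (n : ℂ) * L + π * I + j * L = ((n + j) * L : ℝ) + π * I by push_cast; ring,
    cellWeight_ofReal_add_pi_mul_I]
  congr 6 <;> ring

open Filter Topology in
lemma walkMean_add_four {L : ℝ} (hL : 0 < L) (j : ℕ) :
    walkMean L j 1 1 - walkMean L (j + 4 : ℕ) 1 1 = 4 / thetaHalf L 0 ^ 2 *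
      ((1 - Real.exp (-((j + 1 : ℕ) * L)))⁻¹ - 2 * (1 - Real.exp (-((j + 2 : ℕ) * L)))⁻¹ +
        (1 - Real.exp (-((j + 3 : ℕ) * L)))⁻¹ : ℝ) := by
  set M : ℂ → ℂ := fun z => thetaQuot L z * thetaQuot L (z - L) with hM
  have hU := thetaHalf_zero_ne_zero hL
  have hXd : ∀ z : ℂ, 0 < z.re → z.re < 8 * L → Complex.exp (z - (4 : ℤ) * L) ≠ -1 →
      DifferentiableAt ℂ (thetaQuot L) z := fun z h1 h2 h3 =>
    differentiableAt_thetaQuot hL h1 h2 (by exact_mod_cast h3)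
  have hYd : ∀ z : ℂ, L < z.re → z.re < 8 * L → Complex.exp (z - (5 : ℤ) * L) ≠ -1 →
      DifferentiableAt ℂ (fun z => thetaQuot L (z - L)) z := by
    intro z h1 h2 h3
    have := hXd (z - L) (by simpa using h1) (by simp; linarith) (by
      convert h3 using 2
      push_cast
      ring)
    exact this.comp (f := fun z : ℂ => z - L) z (by fun_prop)
  have hper : ∀ z, M (z + 2 * π * I) = M z := by
    intro z
    simp only [hM]
    rw [add_sub_right_comm, thetaQuot_add_two_pi_I, thetaQuot_add_two_pi_I]
    ring
  have hre : ∀ (z : ℂ) (k : ℤ), z.re ≠ k * L → Complex.exp (z - k * L) ≠ -1 := by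
    intro z k h
    refine exp_ne_neg_one_of_re_ne_zero ?_
    simpa using sub_ne_zero.mpr h
  have s3 := lineMean_mul_cellWeight_shift hL (M := M) 3 j
    (fun z h1 h2 => by
      push_cast at h1 h2
      refine (hXd z (by linarith) (by linarith) (hre _ _ ?_)).mul
        (hYd z (by linarith) (by linarith) (hre _ _ ?_)) <;>
      · push_cast
        exact ne_of_lt (by linarith))
    hper (by
      simp only [hM]
      rw [show ((3 : ℤ) : ℂ) * L + π * I - L = 2 * L + π * I by push_cast; ring,
        thetaQuot_two_mul_add_pi_mul_I, mul_zero])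
  have s6 := lineMean_mul_cellWeight_shift hL (M := M) 6 j
    (fun z h1 h2 => by
      push_cast at h1 h2
      refine (hXd z (by linarith) (by linarith) (hre _ _ ?_)).mul
        (hYd z (by linarith) (by linarith) (hre _ _ ?_)) <;>
      · push_cast
        exact ne_of_gt (by linarith))
    hper (by
      simp only [hM]
      rw [← thetaQuot_sub_four_mul L (_ + _),
        show ((6 : ℤ) : ℂ) * L + π * I - 4 * L = 2 * L + π * I by push_cast; ring,
        thetaQuot_two_mul_add_pi_mul_I, zero_mul])
  have hj : (0 : ℝ) ≤ j := j.cast_nonneg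
  have w4 := tendsto_cellWeight_add (L := L) 4 j
    (mul_ne_zero (by push_cast; linarith) hL.ne') (mul_ne_zero (by push_cast; linarith) hL.ne')
  have w5 := tendsto_cellWeight_add (L := L) 5 j
    (mul_ne_zero (by push_cast; linarith) hL.ne') (mul_ne_zero (by push_cast; linarith) hL.ne')
  have x4 := tendsto_mul_thetaQuot hL
  have y4 := (hYd (4 * L + π * I) (by simp; linarith) (by simp; linarith)
    (hre _ _ (by simp; intro h; linarith))).continuousAt.tendsto.mono_left
    (nhdsWithin_le_nhds (s := {(4 * L + π * I : ℂ)}ᶜ))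
  have x5 := (hXd (5 * L + π * I) (by simp; linarith) (by simp; linarith)
    (hre _ _ (by simp; intro h; linarith))).continuousAt.tendsto.mono_left
    (nhdsWithin_le_nhds (s := {(5 * L + π * I : ℂ)}ᶜ))
  have y5 : Tendsto (fun z => (z - (5 * L + π * I)) * thetaQuot L (z - L))
      (𝓝[≠] (5 * L + π * I)) (𝓝 (4 / (I * thetaHalf L 0 ^ 2))) := by
    have := tendsto_sub_const_punctured (4 * L + π * I) L
    rw [show (L : ℂ) + (4 * L + π * I) = 5 * L + π * I by ring] at this
    refine (x4.comp this).congr fun z => ?_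
    simp only [Function.comp]
    ring
  rw [show 4 * (L : ℂ) + π * I - L = 3 * L + π * I by ring,
    thetaQuot_three_mul_add_pi_mul_I hL] at y4
  rw [← thetaQuot_sub_four_mul, show 5 * (L : ℂ) + π * I - 4 * L = L + π * I by ring,
    thetaQuot_add_pi_mul_I hL] at x5
  push_cast at w4 w5
  have s4 := lineMean_mul_cellWeight_sub hL (M := M) 4 j
    (fun z h1 h2 h3 => by
      push_cast at h1 h2
      exact (hXd z (by linarith) (by linarith) (h3 4)).mul
        (hYd z (by linarith) (by linarith) (h3 5)))
    hper (by
      push_cast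
      exact ((x4.mul y4).mul w4).congr fun z => by simp only [hM]; ring)
  have s5 := lineMean_mul_cellWeight_sub hL (M := M) 5 j
    (fun z h1 h2 h3 => by
      push_cast at h1 h2
      exact (hXd z (by linarith) (by linarith) (h3 4)).mul
        (hYd z (by linarith) (by linarith) (h3 5)))
    hper (by
      push_cast
      exact ((y5.mul x5).mul w5).congr fun z => by simp only [hM]; ring)
  have e1 : walkMean L j 1 1 =
      lineMean (fun z => M z * cellWeight L (z + (j : ℤ) * L)) (((3 : ℤ) - 1 / 2) * L) := by
    rw [walkMean]
    simp only [pow_one, hM]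
    congr 1
    push_cast
    ring
  have e2 : walkMean L (j + 4 : ℕ) 1 1 =
      lineMean (fun z => M z * cellWeight L (z + (j : ℤ) * L)) (((6 : ℤ) + 1 / 2) * L) := by
    rw [walkMean, show 5 / 2 * L = ((6 : ℤ) + 1 / 2) * L - 4 * L by push_cast; ring,
      ← lineMean_comp_sub]
    refine lineMean_congr fun s => ?_
    simp only [pow_one, hM]
    congr 2
    · refine Eq.trans ?_ (thetaQuot_sub_four_mul L _)
      push_cast
      rfl
    · refine Eq.trans ?_ (thetaQuot_sub_four_mul L _)
      congr 1
      push_cast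
      ring
    · push_cast
      ring
  have b3 : ((3 : ℤ) + 1 / 2 : ℝ) * L = ((4 : ℤ) - 1 / 2) * L := by push_cast; ring
  have b4 : ((4 : ℤ) + 1 / 2 : ℝ) * L = ((5 : ℤ) - 1 / 2) * L := by push_cast; ring
  have b5 : ((5 : ℤ) + 1 / 2 : ℝ) * L = ((6 : ℤ) - 1 / 2) * L := by push_cast; ring
  rw [e1, e2, s3, b3, ← s6, ← b5]
  rw [b4] at s4
  rw [← neg_sub, ← sub_add_sub_cancel _
    (lineMean (fun z => M z * cellWeight L (z + (j : ℤ) * L)) (((5 : ℤ) - 1 / 2) * L)), s4, s5]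
  have k1 : ((4 : ℂ) + j - 2) * L = (j + 2) * L := by ring
  have k2 : ((4 : ℂ) + j - 3) * L = (j + 1) * L := by ring
  have k3 : ((5 : ℂ) + j - 2) * L = (j + 3) * L := by ring
  have k4 : ((5 : ℂ) + j - 3) * L = (j + 2) * L := by ring
  rw [k1, k2, k3, k4]
  have hI : 4 / (I * thetaHalf L 0 ^ 2) * I = 4 / thetaHalf L 0 ^ 2 := by
    field_simp
  push_cast
  rw [mul_neg, hI]
  ring

/-- The Lambert-type series giving the excursion generating functions. -/
def excSeries (q : ℝ) (j : ℕ) : ℝ :=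
  ∑' n : ℕ, (1 - q ^ (n + 1)) ^ 2 / (1 - q ^ (4 * (n + 1))) * q ^ ((n + 1) * (j + 1))

lemma hasSum_pow_succ_mul {q : ℝ} (h0 : 0 < q) (h1 : q < 1) {m : ℕ} (hm : m ≠ 0) :
    HasSum (fun n : ℕ => q ^ ((n + 1) * m)) ((1 - q ^ m)⁻¹ - 1) := by
  have h := hasSum_geometric_of_lt_one (pow_nonneg h0.le m) (pow_lt_one₀ h0.le h1 hm)
  have h2 := (hasSum_nat_add_iff' 1).mpr h
  simp only [Finset.range_one, Finset.sum_singleton, pow_zero] at h2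
  refine h2.congr_fun fun n => ?_
  rw [← pow_mul, mul_comm]

lemma excSeries_term_mem {q : ℝ} (h0 : 0 < q) (h1 : q < 1) (j n : ℕ) :
    0 ≤ (1 - q ^ (n + 1)) ^ 2 / (1 - q ^ (4 * (n + 1))) * q ^ ((n + 1) * (j + 1)) ∧
      (1 - q ^ (n + 1)) ^ 2 / (1 - q ^ (4 * (n + 1))) * q ^ ((n + 1) * (j + 1)) ≤
        q ^ ((n + 1) * (j + 1)) := by
  have hx0 : 0 < q ^ (n + 1) := pow_pos h0 _
  have hx1 : q ^ (n + 1) < 1 := pow_lt_one₀ h0.le h1 (by omega)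
  have hx4 : q ^ (4 * (n + 1)) ≤ q ^ (n + 1) := pow_le_pow_of_le_one h0.le h1.le (by omega)
  have hd : 0 < 1 - q ^ (4 * (n + 1)) := by linarith
  refine ⟨by positivity, mul_le_of_le_one_left (by positivity) ?_⟩
  rw [div_le_one hd]
  nlinarith

lemma summable_excSeries {q : ℝ} (h0 : 0 < q) (h1 : q < 1) (j : ℕ) :
    Summable fun n : ℕ =>
      (1 - q ^ (n + 1)) ^ 2 / (1 - q ^ (4 * (n + 1))) * q ^ ((n + 1) * (j + 1)) :=
  Summable.of_nonneg_of_le (fun n => (excSeries_term_mem h0 h1 j n).1)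
    (fun n => (excSeries_term_mem h0 h1 j n).2) (hasSum_pow_succ_mul h0 h1 (by omega)).summable

lemma excSeries_sub {q : ℝ} (h0 : 0 < q) (h1 : q < 1) (j : ℕ) :
    excSeries q j - excSeries q (j + 4) =
      (1 - q ^ (j + 1))⁻¹ - 2 * (1 - q ^ (j + 2))⁻¹ + (1 - q ^ (j + 3))⁻¹ := by
  have hs := (summable_excSeries h0 h1 j).hasSum.sub (summable_excSeries h0 h1 (j + 4)).hasSum
  have hg := ((hasSum_pow_succ_mul h0 h1 (m := j + 1) (by omega)).sub
    ((hasSum_pow_succ_mul h0 h1 (m := j + 2) (by omega)).mul_left 2)).add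
    (hasSum_pow_succ_mul h0 h1 (m := j + 3) (by omega))
  rw [excSeries, excSeries]
  refine (hs.unique (hg.congr_fun fun n => ?_)).trans (by ring)
  have hx4 : q ^ (4 * (n + 1)) < 1 := pow_lt_one₀ h0.le h1 (by omega)
  have hd : 1 - (q ^ (n + 1)) ^ 4 ≠ 0 := by
    rw [← pow_mul, mul_comm]
    linarith
  rw [mul_comm 4, pow_mul q (n + 1) 4, pow_mul, pow_mul, pow_mul, pow_mul]
  field_simp
  ring

open Filter Topology in
lemma tendsto_excSeries {q : ℝ} (h0 : 0 < q) (h1 : q < 1) :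
    Tendsto (excSeries q) atTop (𝓝 0) := by
  have hq : Tendsto (fun j : ℕ => (1 - q ^ (j + 1))⁻¹ - 1) atTop (𝓝 0) := by
    have := ((tendsto_pow_atTop_nhds_zero_of_lt_one h0.le h1).comp (tendsto_add_atTop_nat 1))
    have h2 := ((tendsto_const_nhds (x := (1 : ℝ))).sub this).inv₀ (by norm_num)
    simpa using h2.sub_const 1
  refine squeeze_zero (fun j => tsum_nonneg fun n => (excSeries_term_mem h0 h1 j n).1)
    (fun j => ?_) hq
  rw [← (hasSum_pow_succ_mul h0 h1 (m := j + 1) (by omega)).tsum_eq]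
  exact (summable_excSeries h0 h1 j).tsum_le_tsum (fun n => (excSeries_term_mem h0 h1 j n).2)
    (hasSum_pow_succ_mul h0 h1 (by omega)).summable

open Filter Topology in
lemma tendsto_walkMean {L t : ℝ} (hL : 0 < L) (ht0 : 0 < t) (ht1 : t < 1 / 4)
    (ht : 4 * (t : ℂ) * thetaInt L 0 ^ 2 = thetaHalf L 0 ^ 2) :
    Tendsto (fun j : ℕ => walkMean L j 1 1) atTop (𝓝 0) := by
  set C := (1 - Real.exp (-(L / 2)))⁻¹ with hC
  have hlim : Tendsto (fun j : ℕ => 2 * Real.exp (L / 2) * C ^ 2 * Real.exp (-L) ^ j) atTop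
      (𝓝 0) := by
    simpa using (tendsto_pow_atTop_nhds_zero_of_lt_one (Real.exp_pos (-L)).le
      (by rw [Real.exp_lt_one_iff]; linarith)).const_mul (2 * Real.exp (L / 2) * C ^ 2)
  refine squeeze_zero_norm (fun j => norm_lineMean_le fun s => ?_) hlim
  have hn := (norm_thetaQuot_lt_one hL ht0 ht1 ht s).le
  rw [thetaQuot_sub_eq_conj, norm_mul, norm_mul, norm_pow, norm_pow, RCLike.norm_conj, pow_one]
  refine le_trans (mul_le_of_le_one_left (norm_nonneg _)
    (mul_le_one₀ hn (norm_nonneg _) hn)) ?_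
  have r2 := re_line_sub L j 2 s
  have r3 := re_line_sub L j 3 s
  have n2 := norm_logistic_le (half_pos hL) (r2 ▸ half_mul_le_abs_half_odd_mul hL (2 + j - 2))
  have n3 := norm_logistic_le (half_pos hL) (r3 ▸ half_mul_le_abs_half_odd_mul hL (2 + j - 3))
  have z2 := exp_ne_neg_one_of_re_ne_zero (r2 ▸ half_odd_mul_ne_zero hL (2 + j - 2))
  have z3 := exp_ne_neg_one_of_re_ne_zero (r3 ▸ half_odd_mul_ne_zero hL (2 + j - 3))
  rw [cellWeight]
  push_cast at r2 r3 n2 n3 z2 z3 ⊢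
  set a : ℂ := 5 / 2 * L + s * I + j * L - 2 * L
  set b : ℂ := 5 / 2 * L + s * I + j * L - 3 * L
  have hne : ∀ z : ℂ, Complex.exp z ≠ -1 → 1 + Complex.exp (-z) ≠ 0 := by
    intro z hz h
    apply hz
    rw [← inv_inv (Complex.exp z), ← Complex.exp_neg, ← neg_eq_of_add_eq_zero_right h]
    norm_num
  have e : logistic a - logistic b =
      (Complex.exp (-b) - Complex.exp (-a)) * (logistic a * logistic b) := by
    rw [logistic, logistic]
    have := hne a z2
    have := hne b z3
    field_simp
    ring
  rw [e, norm_mul, norm_mul]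
  have hexp : ‖Complex.exp (-b) - Complex.exp (-a)‖ ≤
      2 * Real.exp (L / 2) * Real.exp (-L) ^ j := by
    refine (norm_sub_le _ _).trans ?_
    rw [Complex.norm_exp, Complex.norm_exp, neg_re, neg_re, r2, r3, ← Real.exp_nat_mul, mul_assoc,
      ← Real.exp_add, two_mul]
    refine add_le_add (Real.exp_le_exp.mpr ?_) (Real.exp_le_exp.mpr ?_) <;> nlinarith
  have hC0 : 0 ≤ C := (norm_nonneg _).trans n2
  calc _ ≤ 2 * Real.exp (L / 2) * Real.exp (-L) ^ j * (C * C) := by gcongr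
    _ = _ := by ring

open Filter Topology in
/-- Closed form of the excursion means. -/
lemma walkMean_eq_excSeries {L t : ℝ} (hL : 0 < L) (ht0 : 0 < t) (ht1 : t < 1 / 4)
    (ht : 4 * (t : ℂ) * thetaInt L 0 ^ 2 = thetaHalf L 0 ^ 2) (j : ℕ) :
    walkMean L j 1 1 = 4 / thetaHalf L 0 ^ 2 * (excSeries (Real.exp (-L)) j : ℝ) := by
  have hq0 := Real.exp_pos (-L)
  have hq1 : Real.exp (-L) < 1 := by rw [Real.exp_lt_one_iff]; linarith
  set D : ℕ → ℂ := fun j =>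
    walkMean L j 1 1 - 4 / thetaHalf L 0 ^ 2 * (excSeries (Real.exp (-L)) j : ℝ) with hD
  have hstep : ∀ j, D (j + 4) = D j := by
    intro j
    have h1 := walkMean_add_four hL j
    have h2 := excSeries_sub hq0 hq1 j
    simp only [← Real.exp_nat_mul] at h2
    have e : ∀ n : ℕ, (n : ℝ) * -L = -(n * L) := fun n => by ring
    rw [e, e, e] at h2
    rw [← h2] at h1
    simp only [hD]
    push_cast at h1 ⊢
    linear_combination -h1
  have hlim : Tendsto D atTop (𝓝 0) := by
    have h2 := (continuous_ofReal.tendsto 0).comp (tendsto_excSeries hq0 hq1)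
    simpa using (tendsto_walkMean hL ht0 ht1 ht).sub (h2.const_mul (4 / thetaHalf L 0 ^ 2))
  have hconst : ∀ N : ℕ, D (j + 4 * N) = D j := by
    intro N
    induction N with
    | zero => rfl
    | succ N ih => rw [mul_add, mul_one, ← add_assoc, hstep, ih]
  have h4 : Tendsto (fun N : ℕ => j + 4 * N) atTop atTop :=
    tendsto_atTop_mono (fun N => by simp only [id]; omega) tendsto_id
  have h0 : D j = 0 :=
    tendsto_nhds_unique (tendsto_const_nhds.congr fun N => (hconst N).symm) (hlim.comp h4)
  exact sub_eq_zero.mp h0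

open MeasureTheory in
lemma intervalIntegral_zero_one_eq_image {φ φ' : ℝ → ℝ} {b : ℝ} (hb : 0 < b) (h0 : φ 0 = 0)
    (h1 : φ b = 1) (hd : ∀ x ∈ Icc 0 b, HasDerivAt φ (φ' x) x)
    (hpos : ∀ x ∈ Ioo 0 b, 0 < φ' x) (g : ℝ → ℝ) :
    ∫ y in (0 : ℝ)..1, g y = ∫ x in (0 : ℝ)..b, φ' x * g (φ x) := by
  have hc : ContinuousOn φ (Icc 0 b) := fun x hx => (hd x hx).continuousAt.continuousWithinAt
  have hm : StrictMonoOn φ (Icc 0 b) := strictMonoOn_of_deriv_pos (convex_Icc _ _) hc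
    (fun x hx => by
      rw [interior_Icc] at hx
      rw [(hd x (Ioo_subset_Icc_self hx)).deriv]
      exact hpos x hx)
  have himg : φ '' Ioo 0 b = Ioo 0 1 := by
    apply Subset.antisymm
    · rintro _ ⟨x, hx, rfl⟩
      refine ⟨?_, ?_⟩
      · rw [← h0]
        exact hm ⟨le_rfl, hb.le⟩ (Ioo_subset_Icc_self hx) hx.1
      · rw [← h1]
        exact hm (Ioo_subset_Icc_self hx) ⟨hb.le, le_rfl⟩ hx.2
    · have := intermediate_value_Ioo hb.le hc
      rwa [h0, h1] at this
  rw [intervalIntegral.integral_of_le zero_le_one, intervalIntegral.integral_of_le hb.le,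
    integral_Ioc_eq_integral_Ioo, integral_Ioc_eq_integral_Ioo, ← himg,
    integral_image_eq_integral_abs_deriv_smul measurableSet_Ioo
      (fun x hx => (hd x (Ioo_subset_Icc_self hx)).hasDerivWithinAt)
      (hm.injOn.mono Ioo_subset_Icc_self)]
  refine setIntegral_congr_fun measurableSet_Ioo fun x hx => ?_
  simp only [smul_eq_mul]
  rw [abs_of_pos (hpos x hx)]

open MeasureTheory in
lemma Kell_eq_integral_sin (k : ℝ) :
    Kell k = ∫ x in (0 : ℝ)..(π / 2), 1 / √(1 - k ^ 2 * Real.sin x ^ 2) := by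
  have hπ := Real.pi_pos
  have hcos : ∀ x ∈ Ioo 0 (π / 2), 0 < Real.cos x := fun x hx =>
    Real.cos_pos_of_mem_Ioo ⟨by linarith [hx.1], hx.2⟩
  rw [Kell, intervalIntegral_zero_one_eq_image (by positivity) Real.sin_zero Real.sin_pi_div_two
    (fun x _ => Real.hasDerivAt_sin x) hcos,
    intervalIntegral.integral_of_le (by positivity),
    intervalIntegral.integral_of_le (by positivity),
    integral_Ioc_eq_integral_Ioo, integral_Ioc_eq_integral_Ioo]
  refine setIntegral_congr_fun measurableSet_Ioo fun x hx => ?_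
  have h := hcos x hx
  rw [← Real.cos_sq', Real.sqrt_mul (sq_nonneg _), Real.sqrt_sq h.le, one_div, one_div, mul_inv,
    ← mul_assoc, mul_inv_cancel₀ h.ne', one_mul]

open MeasureTheory in
/-- The ascending Landen transformation. -/
lemma Kell_landen {κ : ℝ} (h0 : 0 ≤ κ) (h1 : κ < 1) :
    Kell (2 * √κ / (1 + κ)) = (1 + κ) * Kell κ := by
  have hden : ∀ x : ℝ, 0 < 1 + κ * x ^ 2 := fun x => by positivity
  have hnum : ∀ x ∈ Icc (0 : ℝ) 1, 0 < 1 - κ * x ^ 2 := fun x hx => by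
    have : x ^ 2 ≤ 1 := pow_le_one₀ hx.1 hx.2
    nlinarith
  have hd : ∀ x ∈ Icc (0 : ℝ) 1, HasDerivAt (fun s => (1 + κ) * s / (1 + κ * s ^ 2))
      ((1 + κ) * (1 - κ * x ^ 2) / (1 + κ * x ^ 2) ^ 2) x := by
    intro x _
    have := ((hasDerivAt_id x).const_mul (1 + κ)).div
      (((hasDerivAt_pow 2 x).const_mul κ).const_add 1) (hden x).ne'
    refine this.congr_deriv ?_
    simp
    ring
  have hpos : ∀ x ∈ Ioo (0 : ℝ) 1, 0 < (1 + κ) * (1 - κ * x ^ 2) / (1 + κ * x ^ 2) ^ 2 :=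
    fun x hx => by
      have := hnum x (Ioo_subset_Icc_self hx)
      have := hden x
      positivity
  rw [Kell, intervalIntegral_zero_one_eq_image one_pos (by simp)
    (by rw [one_pow, mul_one, mul_one, div_self (by linarith)]) hd hpos, Kell,
    ← intervalIntegral.integral_const_mul,
    intervalIntegral.integral_of_le zero_le_one, intervalIntegral.integral_of_le zero_le_one,
    integral_Ioc_eq_integral_Ioo, integral_Ioc_eq_integral_Ioo]
  refine setIntegral_congr_fun measurableSet_Ioo fun x hx => ?_
  have hn := hnum x (Ioo_subset_Icc_self hx)
  have hdx := hden x
  have hκ : 0 < 1 + κ := by linarith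
  have hx2 : x ^ 2 < 1 := pow_lt_one₀ hx.1.le hx.2 two_ne_zero
  have ha : 0 < (1 - x ^ 2) * (1 - κ ^ 2 * x ^ 2) := by
    have : κ ^ 2 * x ^ 2 < 1 := by nlinarith
    exact mul_pos (by linarith) (by linarith)
  have e : (1 - ((1 + κ) * x / (1 + κ * x ^ 2)) ^ 2) *
      (1 - (2 * √κ / (1 + κ)) ^ 2 * ((1 + κ) * x / (1 + κ * x ^ 2)) ^ 2) =
      ((1 - x ^ 2) * (1 - κ ^ 2 * x ^ 2)) * ((1 - κ * x ^ 2) / (1 + κ * x ^ 2) ^ 2) ^ 2 := by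
    rw [div_pow (2 * √κ), mul_pow 2, Real.sq_sqrt h0]
    field_simp
    ring
  rw [e, Real.sqrt_mul ha.le, Real.sqrt_sq (by positivity)]
  have := Real.sqrt_pos.mpr ha
  field_simp

lemma Kell_mem {k : ℝ} (h1 : k ^ 2 < 1) :
    π / 2 ≤ Kell k ∧ Kell k ≤ π / 2 * (1 / √(1 - k ^ 2)) := by
  have hπ := Real.pi_pos
  have hs : ∀ x, 1 - k ^ 2 ≤ 1 - k ^ 2 * Real.sin x ^ 2 := fun x => by
    have := Real.sin_sq_le_one x
    nlinarith [sq_nonneg k]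
  have hp : ∀ x, 0 < √(1 - k ^ 2 * Real.sin x ^ 2) := fun x =>
    Real.sqrt_pos.mpr (by linarith [hs x])
  have hInt : IntervalIntegrable (fun x => 1 / √(1 - k ^ 2 * Real.sin x ^ 2)) MeasureTheory.volume
      0 (π / 2) := by
    refine Continuous.intervalIntegrable ?_ _ _
    exact continuous_const.div (by fun_prop) fun x => (hp x).ne'
  have hπ2 : (0 : ℝ) ≤ π / 2 := by positivity
  have e : ∀ c : ℝ, ∫ _ in (0 : ℝ)..(π / 2), c = π / 2 * c := fun c => by simp
  rw [Kell_eq_integral_sin]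
  constructor
  · calc π / 2 = ∫ _ in (0 : ℝ)..(π / 2), (1 : ℝ) := by rw [e, mul_one]
      _ ≤ _ := intervalIntegral.integral_mono_on hπ2 (by simp) hInt fun x _ => by
        rw [le_div_iff₀ (hp x), one_mul, Real.sqrt_le_one]
        nlinarith [mul_nonneg (sq_nonneg k) (sq_nonneg (Real.sin x))]
  · rw [← e]
    refine intervalIntegral.integral_mono_on hπ2 hInt (by simp) fun x _ => ?_
    exact one_div_le_one_div_of_le (Real.sqrt_pos.mpr (by linarith)) (Real.sqrt_le_sqrt (hs x))

open Filter Topology in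
lemma tendsto_Kell_zero : Tendsto Kell (𝓝 0) (𝓝 (π / 2)) := by
  have hev : ∀ᶠ k : ℝ in 𝓝 0, k ^ 2 < 1 := by
    have : Tendsto (fun k : ℝ => k ^ 2) (𝓝 0) (𝓝 (0 ^ 2)) := (continuous_pow 2).tendsto 0
    exact this.eventually_lt_const (by norm_num)
  have hlim : Tendsto (fun k : ℝ => π / 2 * (1 / √(1 - k ^ 2))) (𝓝 0) (𝓝 (π / 2)) := by
    have : ContinuousAt (fun k : ℝ => π / 2 * (1 / √(1 - k ^ 2))) 0 :=
      continuousAt_const.mul (continuousAt_const.div (by fun_prop) (by simp))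
    simpa using this.tendsto
  exact tendsto_of_tendsto_of_tendsto_of_le_of_le' tendsto_const_nhds hlim
    (hev.mono fun k hk => (Kell_mem hk).1) (hev.mono fun k hk => (Kell_mem hk).2)

/-- The theta constant `θ₃`. -/
def thetaThree (L : ℝ) : ℝ := (thetaInt L 0).re

/-- The theta constant `θ₂`. -/
def thetaTwo (L : ℝ) : ℝ := (thetaHalf L 0).re

/-- The theta constant `θ₄`. -/
def thetaFour (L : ℝ) : ℝ := (thetaInt L (π * I)).re

/-- The elliptic modulus with nome `exp (-L)`. -/
def ellMod (L : ℝ) : ℝ := (thetaTwo L / thetaThree L) ^ 2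

lemma ofReal_thetaThree (L : ℝ) : (thetaThree L : ℂ) = thetaInt L 0 :=
  Complex.ext rfl (by simpa using (im_thetaInt_ofReal L 0).symm)

lemma ofReal_thetaTwo (L : ℝ) : (thetaTwo L : ℂ) = thetaHalf L 0 :=
  Complex.ext rfl (by simpa using (im_thetaHalf_ofReal L 0).symm)

lemma ofReal_thetaFour (L : ℝ) : (thetaFour L : ℂ) = thetaInt L (π * I) := by
  refine Complex.conj_eq_iff_re.mp ?_
  rw [conj_thetaInt, ← thetaInt_neg]
  simp

lemma thetaThree_pos {L : ℝ} (hL : 0 < L) : 0 < thetaThree L := by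
  simpa [thetaThree] using re_thetaInt_ofReal_pos hL 0

lemma thetaTwo_pos {L : ℝ} (hL : 0 < L) : 0 < thetaTwo L := by
  simpa [thetaTwo] using re_thetaHalf_ofReal_pos hL 0

lemma thetaFour_ne_zero {L : ℝ} (hL : 0 < L) : thetaFour L ≠ 0 := by
  have := thetaInt_pi_mul_I_ne_zero hL
  rw [← ofReal_thetaFour] at this
  exact_mod_cast this

lemma thetaThree_sq {L : ℝ} (hL : 0 < L) :
    thetaThree L ^ 2 = thetaThree (2 * L) ^ 2 + thetaTwo (2 * L) ^ 2 := by
  have h := thetaInt_sq_add_thetaHalf_sq hL 0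
  rw [← ofReal_thetaThree, ← ofReal_thetaThree, ← ofReal_thetaTwo] at h
  have h' : thetaThree (2 * L) ^ 2 + thetaTwo (2 * L) ^ 2 = thetaThree L * thetaThree L := by
    exact_mod_cast h
  rw [h', sq]

lemma thetaTwo_sq {L : ℝ} (hL : 0 < L) :
    thetaTwo L ^ 2 = 2 * thetaThree (2 * L) * thetaTwo (2 * L) := by
  have h := thetaHalf_mul_thetaHalf_zero hL 0
  rw [← ofReal_thetaThree, ← ofReal_thetaTwo, ← ofReal_thetaTwo] at h
  rw [sq]
  exact_mod_cast h

lemma thetaFour_sq {L : ℝ} (hL : 0 < L) :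
    thetaFour L ^ 2 = thetaThree (2 * L) ^ 2 - thetaTwo (2 * L) ^ 2 := by
  have h := thetaInt_mul_add_thetaHalf_mul hL (π * I) (π * I)
  have e : (π * I + π * I : ℂ) = 0 + 2 * π * I := by ring
  rw [sub_self, e, thetaInt_add_two_pi_I, thetaHalf_add_two_pi_I, ← ofReal_thetaThree,
    ← ofReal_thetaTwo, ← ofReal_thetaFour] at h
  have h' : thetaThree (2 * L) * thetaThree (2 * L) + -thetaTwo (2 * L) * thetaTwo (2 * L) =
      thetaFour L * thetaFour L := by exact_mod_cast h
  linarith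

lemma thetaFour_two_mul_sq {L : ℝ} (hL : 0 < L) :
    thetaFour (2 * L) ^ 2 = thetaFour L * thetaThree L := by
  have h := thetaInt_two_mul_pi_mul_I_sq hL
  rw [← ofReal_thetaThree, ← ofReal_thetaFour, ← ofReal_thetaFour] at h
  exact_mod_cast h

/-- Jacobi's identity between the theta constants. -/
lemma thetaThree_pow_four {L : ℝ} (hL : 0 < L) :
    thetaThree L ^ 4 = thetaTwo L ^ 4 + thetaFour L ^ 4 := by
  obtain ⟨M, rfl⟩ : ∃ M, L = 2 * M := ⟨L / 2, by ring⟩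
  have hM : 0 < M := by linarith
  have h1 := thetaThree_sq hM
  have h2 := thetaFour_sq hM
  have h3 := thetaFour_two_mul_sq hM
  linear_combination (-thetaFour M ^ 2) * h1 - (thetaThree (2 * M) ^ 2 + thetaTwo (2 * M) ^ 2) * h2
    - (thetaFour (2 * M) ^ 2 + thetaFour M * thetaThree M) * h3

lemma ellMod_pos {L : ℝ} (hL : 0 < L) : 0 < ellMod L :=
  pow_pos (div_pos (thetaTwo_pos hL) (thetaThree_pos hL)) 2

lemma one_sub_ellMod_sq {L : ℝ} (hL : 0 < L) :
    1 - ellMod L ^ 2 = ((thetaFour L / thetaThree L) ^ 2) ^ 2 := by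
  have h := thetaThree_pow_four hL
  have h3 := (thetaThree_pos hL).ne'
  rw [ellMod]
  field_simp
  linarith

lemma ellMod_lt_one {L : ℝ} (hL : 0 < L) : ellMod L < 1 := by
  have h := one_sub_ellMod_sq hL
  have h4 := thetaFour_ne_zero hL
  have h3 := (thetaThree_pos hL).ne'
  have : 0 < ((thetaFour L / thetaThree L) ^ 2) ^ 2 := by positivity
  nlinarith [ellMod_pos hL]

lemma Kell_ellMod_div_two_mul {L : ℝ} (hL : 0 < L) :
    Kell (ellMod L) / thetaThree L ^ 2 =
      Kell (ellMod (2 * L)) / thetaThree (2 * L) ^ 2 := by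
  have h2L : 0 < 2 * L := by positivity
  have h3 := thetaThree_pos h2L
  have h2 := thetaTwo_pos h2L
  have h := Kell_landen (ellMod_pos h2L).le (ellMod_lt_one h2L)
  have e : 2 * √(ellMod (2 * L)) / (1 + ellMod (2 * L)) = ellMod L := by
    rw [ellMod, Real.sqrt_sq (by positivity), ellMod, div_pow, div_pow, thetaThree_sq hL,
      thetaTwo_sq hL]
    field_simp
  rw [e] at h
  rw [h, thetaThree_sq hL, ellMod]
  field_simp

open Filter Topology in
lemma tendsto_thetaThree : Tendsto thetaThree atTop (𝓝 1) := by
  have h := (Complex.continuous_re.tendsto _).comp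
    (tendsto_thetaInt_of_re_eq_zero (z := 0) (by simp))
  rwa [one_re] at h

open Filter Topology in
lemma tendsto_thetaTwo : Tendsto thetaTwo atTop (𝓝 0) := by
  have h1 := (Complex.continuous_re.tendsto _).comp (tendsto_thetaHalf 0)
  have h2 : Tendsto (fun L : ℝ => Real.exp (-(L / 4))) atTop (𝓝 0) :=
    Real.tendsto_exp_neg_atTop_nhds_zero.comp (tendsto_id.atTop_div_const (by norm_num))
  have h := h2.mul h1
  rw [zero_mul] at h
  refine h.congr fun L => ?_
  simp only [Function.comp, ← ofReal_thetaTwo]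
  have e : Complex.exp (L / 4) = (Real.exp (L / 4) : ℝ) := by push_cast; rfl
  rw [e, ← ofReal_mul, ofReal_re, ← mul_assoc, ← Real.exp_add, neg_add_cancel, Real.exp_zero,
    one_mul]

open Filter Topology in
lemma tendsto_ellMod : Tendsto ellMod atTop (𝓝 0) := by
  have := (tendsto_thetaTwo.div tendsto_thetaThree one_ne_zero).pow 2
  rwa [zero_div, zero_pow two_ne_zero] at this

open Filter Topology in
lemma Kell_ellMod {L : ℝ} (hL : 0 < L) : Kell (ellMod L) = π / 2 * thetaThree L ^ 2 := by
  have h : ∀ N : ℕ, Kell (ellMod (2 ^ N * L)) / thetaThree (2 ^ N * L) ^ 2 =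
      Kell (ellMod L) / thetaThree L ^ 2 := by
    intro N
    induction N with
    | zero => simp
    | succ N ih =>
      rw [← ih, Kell_ellMod_div_two_mul (L := 2 ^ N * L) (by positivity), pow_succ',
        mul_assoc]
  have hlim := ((tendsto_Kell_zero.comp tendsto_ellMod).div (tendsto_thetaThree.pow 2)
    (by norm_num)).comp (tendsto_two_pow_mul hL)
  have := tendsto_nhds_unique (tendsto_const_nhds.congr fun N => (h N).symm) hlim
  have h3 := thetaThree_pos hL
  rw [div_eq_iff (by positivity)] at this
  rw [this]
  ring

/-- The modular transformation of the theta constants. -/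
lemma exists_theta_modular {L : ℝ} (hL : 0 < L) : ∃ c : ℂ, c ^ 2 = π / L ∧
    thetaInt L 0 = c * thetaInt (π ^ 2 / L) 0 ∧
    thetaInt L (π * I) = c * thetaHalf (π ^ 2 / L) 0 := by
  have hπ : (π : ℂ) ≠ 0 := ofReal_ne_zero.mpr Real.pi_ne_zero
  have hLc : (L : ℂ) ≠ 0 := ofReal_ne_zero.mpr hL.ne'
  have eτ : -1 / (I * L / π) = I * (π ^ 2 / L : ℝ) / π := by
    push_cast
    field_simp
    rw [I_sq]
  refine ⟨1 / (-I * (I * L / π)) ^ (1 / 2 : ℂ), ?_, ?_, ?_⟩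
  · rw [div_pow, ← Complex.cpow_nat_mul]
    have : -I * (I * L / π) = L / π := by
      rw [← mul_div_assoc, ← mul_assoc, neg_mul, I_mul_I, neg_neg, one_mul]
    rw [this]
    norm_num
  · rw [thetaInt_eq_jacobiTheta₂, jacobiTheta₂_functional_equation, eτ,
      thetaInt_eq_jacobiTheta₂]
    simp
  · rw [thetaInt_eq_jacobiTheta₂, jacobiTheta₂_functional_equation, eτ, thetaHalf_eq, zero_sub,
      thetaInt_neg, thetaInt_eq_jacobiTheta₂, mul_assoc]
    congr 2
    · congr 1
      push_cast
      field_simp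
      ring
    · congr 1
      push_cast
      field_simp

lemma exists_thetaThree_modular {L : ℝ} (hL : 0 < L) :
    thetaThree L ^ 2 = π / L * thetaThree (π ^ 2 / L) ^ 2 ∧
      thetaFour L ^ 2 = π / L * thetaTwo (π ^ 2 / L) ^ 2 := by
  obtain ⟨c, hc, h1, h2⟩ := exists_theta_modular hL
  constructor
  · have : (thetaThree L : ℂ) ^ 2 = π / L * thetaThree (π ^ 2 / L) ^ 2 := by
      rw [ofReal_thetaThree, ofReal_thetaThree, h1, mul_pow, hc]
    exact_mod_cast this
  · have : (thetaFour L : ℂ) ^ 2 = π / L * thetaTwo (π ^ 2 / L) ^ 2 := by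
      rw [ofReal_thetaFour, ofReal_thetaTwo, h2, mul_pow, hc]
    exact_mod_cast this

lemma kComp_ellMod {L : ℝ} (hL : 0 < L) : kComp (ellMod L) = ellMod (π ^ 2 / L) := by
  have hπ := Real.pi_pos
  have h3 := thetaThree_pos (L := π ^ 2 / L) (by positivity)
  obtain ⟨e3, e4⟩ := exists_thetaThree_modular hL
  rw [kComp, one_sub_ellMod_sq hL, Real.sqrt_sq (sq_nonneg _), ellMod, div_pow, div_pow, e3, e4]
  field_simp

lemma qNome_ellMod {L : ℝ} (hL : 0 < L) : qNome (ellMod L) = Real.exp (-L) := by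
  have hπ := Real.pi_pos
  have hL' : 0 < π ^ 2 / L := by positivity
  have h3 := thetaThree_pos hL'
  rw [qNome, kComp_ellMod hL, Kell_ellMod hL', Kell_ellMod hL, (exists_thetaThree_modular hL).1]
  congr 1
  field_simp

lemma continuousOn_thetaInt {f : ℝ → ℂ} (hf : Continuous f) :
    ContinuousOn (fun L => thetaInt L (f L)) (Ioi 0) := by
  intro L hL
  simp only [thetaInt_eq_jacobiTheta₂]
  have h := continuousAt_jacobiTheta₂ (f L / (2 * π * I)) (im_I_mul_div_pi_pos hL)
  exact (ContinuousAt.comp (f := fun L : ℝ => ((f L / (2 * π * I), I * L / π) : ℂ × ℂ)) h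
    (by fun_prop)).continuousWithinAt

lemma continuousOn_ellMod : ContinuousOn ellMod (Ioi 0) := by
  have h3 : ContinuousOn thetaThree (Ioi 0) :=
    Complex.continuous_re.comp_continuousOn (continuousOn_thetaInt continuous_const)
  have h2 : ContinuousOn thetaTwo (Ioi 0) := by
    refine Complex.continuous_re.comp_continuousOn ?_
    simp only [thetaHalf_eq]
    exact (by fun_prop : Continuous fun L : ℝ => Complex.exp (-L / 4 + 0 / 2)).continuousOn.mul
      (continuousOn_thetaInt (by fun_prop))
  exact (h2.div h3 fun L hL => (thetaThree_pos hL).ne').pow 2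

lemma exists_ellMod_eq {k : ℝ} (h0 : 0 < k) (h1 : k < 1) : ∃ L, 0 < L ∧ ellMod L = k := by
  have hπ := Real.pi_pos
  have hk : 0 < √(1 - k ^ 2) := Real.sqrt_pos.mpr (by nlinarith)
  obtain ⟨L₁, hL₁, hk₁⟩ := ((Filter.eventually_gt_atTop (0 : ℝ)).and
    (tendsto_ellMod.eventually_lt_const h0)).exists
  obtain ⟨L₂, hL₂, hk₂⟩ := ((Filter.eventually_gt_atTop (0 : ℝ)).and
    (tendsto_ellMod.eventually_lt_const hk)).exists
  have hL₃ : 0 < π ^ 2 / L₂ := by positivity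
  have hk₃ : k ≤ ellMod (π ^ 2 / L₂) := by
    rw [← kComp_ellMod hL₂, kComp]
    refine Real.le_sqrt_of_sq_le ?_
    have := Real.lt_sqrt (ellMod_pos hL₂).le |>.mp hk₂
    linarith
  obtain ⟨L, hL, hLk⟩ := isPreconnected_Ioi.intermediate_value (mem_Ioi.mpr hL₁)
    (mem_Ioi.mpr hL₃) continuousOn_ellMod ⟨hk₁.le, hk₃⟩
  exact ⟨L, hL, hLk⟩

/-- The increment of the winding angle along the step from `p` to `a`; it vanishes if either
endpoint is the origin. -/
def argStep (p a : ℤ × ℤ) : ℝ := (ptC a / ptC p).arg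

/-- The list `l` continues the starting point `p` to a diagonal walk that stops at its first visit
to the origin, with winding angle `θ`. -/
def IsReturn : ℤ × ℤ → ℝ → List (ℤ × ℤ) → Prop
  | p, θ, [] => p = 0 ∧ θ = 0
  | p, θ, a :: l => p ≠ 0 ∧ IsDiagStep p a ∧ IsReturn a (θ - argStep p a) l

/-- The four diagonal steps. -/
def diagSteps : Finset (ℤ × ℤ) := {(1, 1), (1, -1), (-1, -1), (-1, 1)}

lemma isDiagStep_iff {a b : ℤ × ℤ} : IsDiagStep a b ↔ ∃ d ∈ diagSteps, b = a + d := by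
  simp only [IsDiagStep, diagSteps, Finset.mem_insert, Finset.mem_singleton, ← sub_eq_iff_eq_add']
  simp

open Classical in
/-- The lists of length at most `N` satisfying `IsReturn p θ`. -/
def returnWalks : ℕ → ℤ × ℤ → ℝ → Finset (List (ℤ × ℤ))
  | 0, p, θ => if p = 0 ∧ θ = 0 then {[]} else ∅
  | N + 1, p, θ => if p = 0 then if θ = 0 then {[]} else ∅ else
      diagSteps.biUnion fun d =>
        (returnWalks N (p + d) (θ - argStep p (p + d))).image (List.cons (p + d))

lemma mem_returnWalks {N : ℕ} {p : ℤ × ℤ} {θ : ℝ} {l : List (ℤ × ℤ)} :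
    l ∈ returnWalks N p θ ↔ l.length ≤ N ∧ IsReturn p θ l := by
  induction N generalizing p θ l with
  | zero =>
    rw [returnWalks]
    cases l with
    | nil => split_ifs with h <;> simp [IsReturn, h]
    | cons a l => split_ifs with h <;> simp
  | succ N ih =>
    rw [returnWalks]
    by_cases hp : p = 0
    · rw [if_pos hp]
      cases l with
      | nil => split_ifs with h <;> simp [IsReturn, h, hp]
      | cons a l => split_ifs with h <;> simp [IsReturn, hp]
    · rw [if_neg hp]
      cases l with
      | nil => simp [IsReturn, hp]
      | cons a l =>
        simp only [Finset.mem_biUnion, Finset.mem_image, ih, List.cons.injEq, IsReturn,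
          isDiagStep_iff, List.length_cons, Nat.succ_le_succ_iff]
        constructor
        · rintro ⟨d, hd, l', ⟨h1, h2⟩, rfl, rfl⟩
          exact ⟨h1, hp, ⟨d, hd, rfl⟩, h2⟩
        · rintro ⟨h1, -, ⟨d, hd, rfl⟩, h2⟩
          exact ⟨d, hd, l, ⟨h1, h2⟩, rfl, rfl⟩

/-- The generating function of the walks in `returnWalks N p θ`. -/
def returnSum (t : ℝ) (N : ℕ) (p : ℤ × ℤ) (θ : ℝ) : ℝ :=
  ∑ l ∈ returnWalks N p θ, t ^ l.length

lemma returnSum_zero_right (t : ℝ) (N : ℕ) (θ : ℝ) :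
    returnSum t N 0 θ = if θ = 0 then 1 else 0 := by
  cases N <;> simp only [returnSum, returnWalks] <;> split_ifs <;> simp_all

lemma returnSum_zero_left (t : ℝ) {p : ℤ × ℤ} (hp : p ≠ 0) (θ : ℝ) : returnSum t 0 p θ = 0 := by
  simp [returnSum, returnWalks, hp]

lemma sum_diagSteps (f : ℤ × ℤ → ℝ) :
    ∑ d ∈ diagSteps, f d = f (1, 1) + f (1, -1) + f (-1, 1) + f (-1, -1) := by
  simp [diagSteps, Finset.sum_insert]
  ring

lemma returnSum_succ (t : ℝ) (N : ℕ) {p : ℤ × ℤ} (hp : p ≠ 0) (θ : ℝ) :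
    returnSum t (N + 1) p θ =
      t * ∑ d ∈ diagSteps, returnSum t N (p + d) (θ - argStep p (p + d)) := by
  classical
  rw [returnSum, returnWalks, if_neg hp, Finset.sum_biUnion, Finset.mul_sum]
  · refine Finset.sum_congr rfl fun d _ => ?_
    rw [Finset.sum_image (fun a _ b _ h => (List.cons.inj h).2), returnSum, Finset.mul_sum]
    simp only [List.length_cons, pow_succ']
  · intro d _ e _ hde
    simp only [Function.onFun, Finset.disjoint_left, Finset.mem_image]
    rintro _ ⟨l, -, rfl⟩ ⟨l', -, h⟩
    exact hde (add_left_cancel (List.cons.inj h).1).symm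

/-- Rotation by a right angle. -/
def rotPt (p : ℤ × ℤ) : ℤ × ℤ := (-p.2, p.1)

lemma ptC_rotPt (p : ℤ × ℤ) : ptC (rotPt p) = I * ptC p := by
  simp only [ptC, rotPt]
  push_cast
  linear_combination (-(p.2 : ℂ)) * I_mul_I

lemma argStep_rotPt (p a : ℤ × ℤ) : argStep (rotPt p) (rotPt a) = argStep p a := by
  rw [argStep, argStep, ptC_rotPt, ptC_rotPt, mul_div_mul_left _ _ I_ne_zero]

lemma rotPt_eq_zero {p : ℤ × ℤ} : rotPt p = 0 ↔ p = 0 := by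
  simp [rotPt, Prod.ext_iff, and_comm]

lemma returnSum_rotPt (t : ℝ) (N : ℕ) (p : ℤ × ℤ) (θ : ℝ) :
    returnSum t N (rotPt p) θ = returnSum t N p θ := by
  by_cases hp : p = 0
  · subst hp; rfl
  have hp' := mt rotPt_eq_zero.mp hp
  induction N generalizing p θ with
  | zero => rw [returnSum_zero_left t hp, returnSum_zero_left t hp']
  | succ N ih =>
    have ih' : ∀ (a : ℤ × ℤ) (η : ℝ), returnSum t N (rotPt a) η = returnSum t N a η := by
      intro a η
      by_cases ha : a = 0
      · subst ha; rfl
      · exact ih a η ha (mt rotPt_eq_zero.mp ha)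
    have key : ∀ d e : ℤ × ℤ, rotPt (p + d) = rotPt p + e →
        returnSum t N (rotPt p + e) (θ - argStep (rotPt p) (rotPt p + e)) =
          returnSum t N (p + d) (θ - argStep p (p + d)) := by
      intro d e h
      rw [← h, ih', argStep_rotPt]
    rw [returnSum_succ t N hp, returnSum_succ t N hp', sum_diagSteps, sum_diagSteps,
      key (1, -1) (1, 1) (by simp [rotPt]; ring), key (-1, -1) (1, -1) (by simp [rotPt]; ring),
      key (1, 1) (-1, 1) (by simp [rotPt]; ring), key (-1, 1) (-1, -1) (by simp [rotPt]; ring)]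
    ring

lemma arg_div_of_re_pos {a b : ℂ} (ha : 0 < a.re) (hb : 0 ≤ b.re) (hb0 : b ≠ 0) :
    (b / a).arg = b.arg - a.arg := by
  have hπ := Real.pi_pos
  have ha0 : a ≠ 0 := by rintro rfl; simp at ha
  have h1 := abs_lt.mp (abs_arg_lt_pi_div_two_iff.mpr (Or.inl ha))
  have h2 := abs_le.mp (abs_arg_le_pi_div_two_iff.mpr hb)
  have h3 : a⁻¹.arg = -a.arg := by rw [arg_inv, if_neg (by linarith)]
  rw [div_eq_mul_inv, arg_mul hb0 (inv_ne_zero ha0), h3, sub_eq_add_neg]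
  rw [h3]
  constructor <;> linarith

/-- The polar angle of a lattice point, measured from the diagonal direction `(1, 1)`. -/
def diagArg (p : ℤ × ℤ) : ℝ := (ptC p / (1 + I)).arg

lemma ptC_eq_zero {p : ℤ × ℤ} : ptC p = 0 ↔ p = 0 := by
  simp [ptC, Complex.ext_iff, Prod.ext_iff]

lemma one_add_I_ne_zero : (1 + I : ℂ) ≠ 0 := by simp [Complex.ext_iff]

lemma re_ptC_div (p : ℤ × ℤ) : (ptC p / (1 + I)).re = (p.1 + p.2) / 2 := by
  have h : ptC p / (1 + I) = (p.1 + p.2) / 2 + (p.2 - p.1) / 2 * I := by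
    rw [div_eq_iff one_add_I_ne_zero, ptC]
    linear_combination ((p.1 - p.2) / 2 : ℂ) * I_mul_I
  rw [h]
  simp

lemma ptC_div_ne_zero {p : ℤ × ℤ} (hp : p ≠ 0) : ptC p / (1 + I) ≠ 0 :=
  div_ne_zero (mt ptC_eq_zero.mp hp) one_add_I_ne_zero

lemma argStep_eq {p a : ℤ × ℤ} (hp : 0 < p.1 + p.2) (ha : 0 ≤ a.1 + a.2) (ha0 : a ≠ 0) :
    argStep p a = diagArg a - diagArg p := by
  rw [diagArg, diagArg, ← arg_div_of_re_pos _ _ (ptC_div_ne_zero ha0),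
    div_div_div_cancel_right₀ one_add_I_ne_zero, argStep]
  · rw [re_ptC_div]
    have : (0 : ℝ) < p.1 + p.2 := by exact_mod_cast hp
    linarith
  · rw [re_ptC_div]
    have : (0 : ℝ) ≤ a.1 + a.2 := by exact_mod_cast ha
    linarith

lemma diagArg_rotPt {p : ℤ × ℤ} (hp : 0 ≤ p.1 + p.2) (hp0 : p ≠ 0) :
    diagArg (rotPt p) = diagArg p + π / 2 := by
  have hπ := Real.pi_pos
  have hre : 0 ≤ (ptC p / (1 + I)).re := by
    rw [re_ptC_div]
    have : (0 : ℝ) ≤ p.1 + p.2 := by exact_mod_cast hp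
    linarith
  have h2 := abs_le.mp (abs_arg_le_pi_div_two_iff.mpr hre)
  rw [diagArg, diagArg, ptC_rotPt, mul_div_assoc, arg_mul I_ne_zero (ptC_div_ne_zero hp0), arg_I,
    add_comm]
  rw [arg_I]
  constructor <;> linarith

lemma diagArg_one_one : diagArg (1, 1) = 0 := by
  have : ptC (1, 1) = 1 + I := by simp [ptC]
  rw [diagArg, this, div_self one_add_I_ne_zero, arg_one]

lemma diagArg_zero : diagArg 0 = 0 := by
  rw [diagArg, ptC_eq_zero.mpr rfl, zero_div, arg_zero]

/-- The generating function, truncated at length `N`, of the walks from `p` to the origin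
compensating the winding angle `m * π / 2 + diagArg p`. -/
def sectorSum (t : ℝ) (N : ℕ) (m : ℤ) (p : ℤ × ℤ) : ℝ :=
  returnSum t N p (-(m * (π / 2) + diagArg p))

lemma sectorSum_zero (t : ℝ) (N : ℕ) (m : ℤ) : sectorSum t N m 0 = if m = 0 then 1 else 0 := by
  rw [sectorSum, returnSum_zero_right, diagArg_zero]
  simp [Real.pi_ne_zero]

lemma sectorSum_rotPt (t : ℝ) (N : ℕ) (m : ℤ) {p : ℤ × ℤ} (hp : 0 ≤ p.1 + p.2) (hp0 : p ≠ 0) :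
    sectorSum t N m (rotPt p) = sectorSum t N (m + 1) p := by
  rw [sectorSum, sectorSum, returnSum_rotPt, diagArg_rotPt hp hp0]
  congr 2
  push_cast
  ring

lemma sectorSum_succ (t : ℝ) (N : ℕ) (m : ℤ) {p : ℤ × ℤ} (hp : 0 < p.1 + p.2)
    (h : ∀ d ∈ diagSteps, p + d = 0 ∧ diagArg p = 0 ∨
      0 ≤ (p + d).1 + (p + d).2 ∧ p + d ≠ 0) :
    sectorSum t (N + 1) m p = t * ∑ d ∈ diagSteps, sectorSum t N m (p + d) := by
  have hp0 : p ≠ 0 := by rintro rfl; simp at hp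
  rw [sectorSum, returnSum_succ t N hp0]
  congr 1
  refine Finset.sum_congr rfl fun d hd => ?_
  rw [sectorSum]
  congr 1
  rcases h d hd with ⟨h0, h1⟩ | ⟨h0, h1⟩
  · rw [h0, h1, diagArg_zero, argStep, ptC_eq_zero.mpr rfl, zero_div, arg_zero, sub_zero]
  · rw [argStep_eq hp h0 h1]
    ring

lemma sectorSum_succ_succ (t : ℝ) (N : ℕ) (m : ℤ) (x y : ℕ) :
    sectorSum t (N + 1) m ((x + 1 : ℕ), (y + 1 : ℕ)) = t *
      (sectorSum t N m ((x + 2 : ℕ), (y + 2 : ℕ)) + sectorSum t N m ((x + 2 : ℕ), y) +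
        sectorSum t N m (x, (y + 2 : ℕ)) + sectorSum t N m (x, y)) := by
  rw [sectorSum_succ, sum_diagSteps]
  · congr 4 <;> congr 1 <;> simp [add_assoc]
  · simp only
    positivity
  · intro d hd
    by_cases h : (((x + 1 : ℕ) : ℤ), ((y + 1 : ℕ) : ℤ)) + d = 0
    · left
      refine ⟨h, ?_⟩
      simp only [diagSteps, Finset.mem_insert, Finset.mem_singleton] at hd
      obtain ⟨rfl, rfl⟩ : x = 0 ∧ y = 0 := by
        rw [Prod.ext_iff] at h
        rcases hd with rfl | rfl | rfl | rfl <;> simp at h <;> omega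
      exact diagArg_one_one
    · right
      refine ⟨?_, h⟩
      simp only [diagSteps, Finset.mem_insert, Finset.mem_singleton] at hd
      rcases hd with rfl | rfl | rfl | rfl <;> simp <;> omega

lemma sectorSum_add_two_zero (t : ℝ) (N : ℕ) (m : ℤ) (x : ℕ) :
    sectorSum t (N + 1) m ((x + 2 : ℕ), (0 : ℕ)) = t *
      (sectorSum t N m ((x + 3 : ℕ), (1 : ℕ)) + sectorSum t N m ((x + 1 : ℕ), (1 : ℕ)) +
        sectorSum t N (m - 1) ((1 : ℕ), (x + 3 : ℕ)) +
        sectorSum t N (m - 1) ((1 : ℕ), (x + 1 : ℕ))) := by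
  have hrot : ∀ z : ℕ, 1 ≤ z →
      sectorSum t N (m - 1) ((1 : ℕ), (z : ℕ)) = sectorSum t N m (z, -1) := by
    intro z hz
    have h := sectorSum_rotPt t N (m - 1) (p := (z, -1)) (by simp; omega) (by simp)
    rw [sub_add_cancel] at h
    rw [← h]
    simp [rotPt]
  rw [sectorSum_succ, sum_diagSteps, hrot _ (by omega), hrot _ (by omega)]
  · have e : ∀ a b c d : ℝ, a + b + c + d = a + c + b + d := fun a b c d => by ring
    rw [e]
    congr 4 <;> congr 1 <;> simp [add_assoc]
  · simp only
    positivity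
  · intro d hd
    right
    simp only [diagSteps, Finset.mem_insert, Finset.mem_singleton] at hd
    rcases hd with rfl | rfl | rfl | rfl <;> simp [Prod.ext_iff] <;> omega

lemma norm_walkMean_sub_sectorSum_le {L t : ℝ} (hL : 0 < L) (ht0 : 0 < t) (ht1 : t < 1 / 4)
    (ht : 4 * (t : ℂ) * thetaInt L 0 ^ 2 = thetaHalf L 0 ^ 2) (N : ℕ) (m : ℤ) (x y : ℕ)
    (hxy : Even (x + y)) :
    ‖walkMean L m x y - (sectorSum t N m (x, y) : ℝ)‖ ≤
      2 * (1 - Real.exp (-(L / 2)))⁻¹ * (4 * t) ^ N := by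
  have hB : 0 ≤ 2 * (1 - Real.exp (-(L / 2)))⁻¹ :=
    (norm_nonneg _).trans (norm_walkMean_le hL ht0 ht1 ht 0 0 0)
  set B := 2 * (1 - Real.exp (-(L / 2)))⁻¹ with hBdef
  have four : ∀ (N : ℕ) (a b c d : ℂ) (a' b' c' d' : ℝ), ‖a - a'‖ ≤ B * (4 * t) ^ N →
      ‖b - b'‖ ≤ B * (4 * t) ^ N → ‖c - c'‖ ≤ B * (4 * t) ^ N → ‖d - d'‖ ≤ B * (4 * t) ^ N →
      ‖t * (a + b + c + d) - (t * (a' + b' + c' + d') : ℝ)‖ ≤ B * (4 * t) ^ (N + 1) := by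
    intro N a b c d a' b' c' d' h1 h2 h3 h4
    have e : t * (a + b + c + d) - (t * (a' + b' + c' + d') : ℝ) =
        t * (((a - a') + (b - b')) + (c - c') + (d - d')) := by
      push_cast; ring
    rw [e, norm_mul, norm_real, Real.norm_of_nonneg ht0.le, pow_succ]
    have := norm_add₄_le (a := a - a') (b := b - b') (c := c - c') (d := d - d')
    nlinarith
  have origin : ∀ (N : ℕ) (m : ℤ),
      ‖walkMean L m 0 0 - (sectorSum t N m ((0 : ℕ), (0 : ℕ)) : ℝ)‖ ≤ B * (4 * t) ^ N := by
    intro N m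
    have h : (((0 : ℕ) : ℤ), ((0 : ℕ) : ℤ)) = 0 := rfl
    rw [walkMean_zero_zero hL m, h, sectorSum_zero]
    split_ifs <;> simp <;> positivity
  induction N generalizing m x y with
  | zero =>
    by_cases h : x = 0 ∧ y = 0
    · rw [h.1, h.2]
      exact origin 0 m
    · rw [sectorSum, returnSum_zero_left t (by simpa [Prod.ext_iff] using h)]
      simpa using norm_walkMean_le hL ht0 ht1 ht m x y
  | succ N ih =>
    have axis : ∀ (m : ℤ) (x : ℕ), Even x →
        ‖walkMean L m x 0 - (sectorSum t (N + 1) m (x, (0 : ℕ)) : ℝ)‖ ≤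
          B * (4 * t) ^ (N + 1) := by
      intro m x hx
      rcases x with _ | _ | x
      · exact origin _ m
      · simp at hx
      · have hx' : Even x := by simpa [Nat.even_add_one] using hx
        rw [walkMean_add_two_zero hL ht m hx', sectorSum_add_two_zero]
        refine four N _ _ _ _ _ _ _ _ (ih _ _ _ ?_) (ih _ _ _ ?_) (ih _ _ _ ?_)
          (ih _ _ _ ?_) <;> simp [hx', parity_simps]
    rcases x with _ | x
    · rcases Nat.eq_zero_or_pos y with rfl | hy
      · exact origin _ m
      · have hy' : Even y := by simpa using hxy
        have h := sectorSum_rotPt t (N + 1) m (p := (y, (0 : ℕ))) (by simp)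
          (by simp [Prod.ext_iff]; omega)
        have e : rotPt ((y : ℤ), ((0 : ℕ) : ℤ)) = (((0 : ℕ) : ℤ), (y : ℤ)) := by simp [rotPt]
        rw [e] at h
        rw [walkMean_zero_left hL m hy' hy.ne', h]
        exact axis _ _ hy'
    · rcases y with _ | y
      · exact axis _ _ (by simpa using hxy)
      · have hxy' : Even (x + y) := by
          rw [show x + 1 + (y + 1) = x + y + 2 by ring] at hxy
          simpa [Nat.even_add] using hxy
        rw [walkMean_succ_succ hL ht, sectorSum_succ_succ]
        refine four N _ _ _ _ _ _ _ _ (ih _ _ _ ?_) (ih _ _ _ ?_) (ih _ _ _ ?_)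
          (ih _ _ _ ?_) <;> simpa [Nat.even_add] using hxy'

open Filter Topology in
lemma tendsto_returnSum {L t : ℝ} (hL : 0 < L) (ht0 : 0 < t) (ht1 : t < 1 / 4)
    (ht : 4 * (t : ℂ) * thetaInt L 0 ^ 2 = thetaHalf L 0 ^ 2) (j : ℤ) :
    Tendsto (fun N => returnSum t N (1, 1) (j * (π / 2))) atTop (𝓝 (walkMean L j 1 1).re) := by
  have h : Tendsto (fun N => 2 * (1 - Real.exp (-(L / 2)))⁻¹ * (4 * t) ^ N) atTop (𝓝 0) := by
    have := (tendsto_pow_atTop_nhds_zero_of_lt_one (r := 4 * t) (by positivity)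
      (by linarith)).const_mul (2 * (1 - Real.exp (-(L / 2)))⁻¹)
    rwa [mul_zero] at this
  rw [tendsto_iff_norm_sub_tendsto_zero]
  refine squeeze_zero (fun _ => norm_nonneg _) (fun N => ?_) h
  have h1 := norm_walkMean_sub_sectorSum_le hL ht0 ht1 ht N (-j) 1 1 (by decide)
  have h2 := (abs_re_le_norm _).trans h1
  rw [walkMean_neg hL, sub_re, ofReal_re, sectorSum] at h2
  have e : (((1 : ℕ) : ℤ), ((1 : ℕ) : ℤ)) = (1, 1) := rfl
  rw [e, diagArg_one_one] at h2
  have e' : -(((-j : ℤ) : ℝ) * (π / 2) + 0) = j * (π / 2) := by push_cast; ring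
  rw [e', abs_sub_comm] at h2
  exact h2

lemma isReturn_iff (p : ℤ × ℤ) (θ : ℝ) (l : List (ℤ × ℤ)) :
    IsReturn p θ l ↔ (p :: l).IsChain IsDiagStep ∧ (p :: l).getLast? = some 0 ∧
      (∀ i < l.length, (p :: l).getD i 0 ≠ 0) ∧
      θ = ∑ i ∈ Finset.range l.length, argStep ((p :: l).getD i 0) ((p :: l).getD (i + 1) 0) := by
  induction l generalizing p θ with
  | nil => simp [IsReturn]
  | cons a l ih =>
    rw [IsReturn, ih, List.length_cons, Finset.sum_range_succ', List.isChain_cons_cons,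
      List.getLast?_cons_cons, sub_eq_iff_eq_add]
    simp only [List.getD_cons_succ, List.getD_cons_zero]
    have h : (∀ i < l.length + 1, (p :: a :: l).getD i 0 ≠ 0) ↔
        p ≠ 0 ∧ ∀ i < l.length, (a :: l).getD i 0 ≠ 0 := by
      constructor
      · intro h
        exact ⟨h 0 (Nat.succ_pos _), fun i hi => h (i + 1) (Nat.succ_lt_succ hi)⟩
      · rintro ⟨h1, h2⟩ (_ | i) hi
        · exact h1
        · exact h2 i (Nat.lt_of_succ_lt_succ hi)
    rw [h]
    tauto

lemma windExc_cons_cons (p a : ℤ × ℤ) (l : List (ℤ × ℤ)) :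
    windExc (p :: a :: l) =
      ∑ i ∈ Finset.range (l.length - 1), argStep ((a :: l).getD i 0) ((a :: l).getD (i + 1) 0) := by
  rw [windExc, windExcTo]
  have e : min ((p :: a :: l).length - 1) ((p :: a :: l).length - 2) = l.length := by
    simp only [List.length_cons]; omega
  rw [e, ← Finset.Ico_add_one_right_eq_Icc, Finset.sum_Ico_eq_sum_range]
  have e' : l.length + 1 - 2 = l.length - 1 := by omega
  rw [e']
  refine Finset.sum_congr rfl fun i _ => ?_
  have e1 : 2 + i = i + 1 + 1 := by omega
  rw [e1, Nat.add_sub_cancel, argStep, List.getD_cons_succ, List.getD_cons_succ,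
    List.getD_cons_succ]

lemma argStep_zero_right (p : ℤ × ℤ) : argStep p 0 = 0 := by
  rw [argStep, ptC_eq_zero.mpr rfl, zero_div, arg_zero]

lemma isExcursion_and_windExc_iff {w : List (ℤ × ℤ)} {α : ℝ} :
    IsExcursion w ∧ windExc w = α ↔
      ∃ d ∈ diagSteps, ∃ l, IsReturn d α l ∧ w = 0 :: d :: l := by
  have key : ∀ (a : ℤ × ℤ) (l : List (ℤ × ℤ)), IsDiagStep 0 a →
      (IsExcursion (0 :: a :: l) ∧ windExc (0 :: a :: l) = α ↔ IsReturn a α l) := by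
    intro a l ha
    have hwind : (a :: l).getLast? = some 0 → windExc (0 :: a :: l) =
        ∑ i ∈ Finset.range l.length, argStep ((a :: l).getD i 0) ((a :: l).getD (i + 1) 0) := by
      intro h
      rw [windExc_cons_cons]
      rcases l.eq_nil_or_concat with rfl | ⟨l', b, rfl⟩
      · rfl
      · have hb : b = 0 := by
          rw [List.concat_eq_append, ← List.cons_append, List.getLast?_concat] at h
          exact Option.some.inj h
        subst hb
        simp only [List.concat_eq_append, List.length_append, List.length_cons, List.length_nil,
          zero_add, Nat.add_sub_cancel, Finset.sum_range_succ]
        have : (a :: (l' ++ [0])).getD (l'.length + 1) 0 = 0 := by simp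
        rw [this, argStep_zero_right, add_zero]
    have hne : (∀ i, 1 ≤ i → i ≤ (0 :: a :: l).length - 2 → (0 :: a :: l).getD i 0 ≠ (0, 0)) ↔
        ∀ i < l.length, (a :: l).getD i 0 ≠ 0 := by
      constructor
      · intro h i hi
        exact h (i + 1) (Nat.succ_pos _) (by simp only [List.length_cons]; omega)
      · rintro h (_ | i) h1 h2
        · omega
        · exact h i (by simp only [List.length_cons] at h2; omega)
    have hchain : (0 :: a :: l).Chain' IsDiagStep ↔ (0 :: a :: l).IsChain IsDiagStep := Iff.rfl
    rw [isReturn_iff, IsExcursion, hne, hchain, List.isChain_cons_cons, List.getLast?_cons_cons]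
    constructor
    · rintro ⟨⟨-, ⟨-, h1⟩, -, h2, h3⟩, h4⟩
      exact ⟨h1, h2, h3, by rw [← h4, hwind h2]⟩
    · rintro ⟨h1, h2, h3, h4⟩
      exact ⟨⟨by simp, ⟨ha, h1⟩, rfl, h2, h3⟩, by rw [h4, hwind h2]⟩
  constructor
  · intro h
    obtain ⟨h2, hc, h0, -⟩ := h.1
    match w, h2, hc, h0, h with
    | b :: a :: l, _, hc, h0, h =>
      obtain rfl : b = 0 := Option.some.inj h0
      have ha : IsDiagStep 0 a := (List.isChain_cons_cons.mp hc).1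
      obtain ⟨d, hd, rfl⟩ := isDiagStep_iff.mp ha
      rw [zero_add] at *
      exact ⟨d, hd, l, (key d l ha).mp h, rfl⟩
  · rintro ⟨d, hd, l, hl, rfl⟩
    exact (key d l (isDiagStep_iff.mpr ⟨d, hd, (zero_add d).symm⟩)).mpr hl

open Classical in
/-- The excursions of length at most `N + 1` with winding angle `α`. -/
def excWalks (N : ℕ) (α : ℝ) : Finset (List (ℤ × ℤ)) :=
  diagSteps.biUnion fun d => (returnWalks N d α).image fun l => 0 :: d :: l

lemma mem_excWalks {N : ℕ} {α : ℝ} {w : List (ℤ × ℤ)} :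
    w ∈ excWalks N α ↔ w.length ≤ N + 2 ∧ IsExcursion w ∧ windExc w = α := by
  rw [isExcursion_and_windExc_iff]
  simp only [excWalks, Finset.mem_biUnion, Finset.mem_image, mem_returnWalks]
  constructor
  · rintro ⟨d, hd, l, ⟨h1, h2⟩, rfl⟩
    exact ⟨by simpa using h1, d, hd, l, h2, rfl⟩
  · rintro ⟨h1, d, hd, l, h2, rfl⟩
    exact ⟨d, hd, l, ⟨by simpa using h1, h2⟩, rfl⟩

lemma sum_excWalks (t : ℝ) (N : ℕ) (α : ℝ) :
    ∑ w ∈ excWalks N α, t ^ (w.length - 1) = 4 * t * returnSum t N (1, 1) α := by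
  classical
  rw [excWalks, Finset.sum_biUnion]
  · have h : ∀ d : ℤ × ℤ, ∑ w ∈ (returnWalks N d α).image (fun l => 0 :: d :: l),
        t ^ (w.length - 1) = t * returnSum t N d α := by
      intro d
      rw [Finset.sum_image (by simp), returnSum, Finset.mul_sum]
      refine Finset.sum_congr rfl fun l _ => ?_
      rw [← pow_succ']
      rfl
    simp only [h]
    have h1 : returnSum t N (-1, 1) α = returnSum t N (1, 1) α := returnSum_rotPt t N (1, 1) α
    have h2 : returnSum t N (-1, -1) α = returnSum t N (-1, 1) α := returnSum_rotPt t N (-1, 1) α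
    have h3 : returnSum t N (1, -1) α = returnSum t N (-1, -1) α := by
      rw [← returnSum_rotPt t N (-1, -1) α]
      simp [rotPt]
    rw [sum_diagSteps, h3, h2, h1]
    ring
  · intro d _ e _ hde
    simp only [Function.onFun, Finset.disjoint_left, Finset.mem_image]
    rintro _ ⟨l, -, rfl⟩ ⟨l', -, h⟩
    exact hde (List.cons.inj (List.cons.inj h).2).1.symm

open Filter Topology in
lemma hasSum_subtype_of_tendsto_finset_sum {β : Type*} {P : β → Prop} {f : β → ℝ}
    (hf : ∀ b, 0 ≤ f b) (V : ℕ → Finset β) (hV : ∀ N, ∀ b ∈ V N, P b)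
    (hP : ∀ b, P b → ∀ᶠ N in atTop, b ∈ V N) {a : ℝ}
    (ha : Tendsto (fun N => ∑ b ∈ V N, f b) atTop (𝓝 a)) :
    HasSum (fun b : {b // P b} => f b) a := by
  classical
  refine hasSum_of_isLUB_of_nonneg a (fun b => hf b) ⟨?_, ?_⟩
  · rintro _ ⟨s, rfl⟩
    have hs : ∀ᶠ N in atTop, ∀ b ∈ s, (b : β) ∈ V N :=
      (eventually_all_finset s).mpr fun b _ => hP b b.2
    refine ge_of_tendsto ha (hs.mono fun N hN => ?_)
    change ∑ b ∈ s, f (Function.Embedding.subtype P b) ≤ _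
    rw [← Finset.sum_map s (Function.Embedding.subtype P) f]
    refine Finset.sum_le_sum_of_subset_of_nonneg (fun b hb => ?_) fun b _ _ => hf b
    obtain ⟨c, hc, rfl⟩ := Finset.mem_map.mp hb
    exact hN c hc
  · intro b hb
    refine le_of_tendsto' ha fun N => ?_
    rw [← Finset.sum_subtype_of_mem f (hV N)]
    exact hb ⟨_, rfl⟩

lemma hasSum_excursions {L t : ℝ} (hL : 0 < L) (ht0 : 0 < t) (ht1 : t < 1 / 4)
    (ht : 4 * (t : ℂ) * thetaInt L 0 ^ 2 = thetaHalf L 0 ^ 2) (j : ℤ) :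
    HasSum (fun w : {w : List (ℤ × ℤ) // IsExcursion w ∧ windExc w = π / 2 * j} =>
      t ^ (w.val.length - 1)) (4 * t * (walkMean L j 1 1).re) := by
  refine hasSum_subtype_of_tendsto_finset_sum (f := fun w => t ^ (w.length - 1))
    (fun w => by positivity) (fun N => excWalks N (π / 2 * j))
    (fun N w hw => (mem_excWalks.mp hw).2) (fun w hw => ?_) ?_
  · filter_upwards [Filter.eventually_ge_atTop w.length] with N hN
    exact mem_excWalks.mpr ⟨by omega, hw⟩
  · simp only [sum_excWalks, mul_comm (π / 2) (j : ℝ)]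
    exact (tendsto_returnSum hL ht0 ht1 ht j).const_mul _

lemma hasSum_excursions_excSeries {L t : ℝ} (hL : 0 < L) (ht0 : 0 < t) (ht1 : t < 1 / 4)
    (ht : 4 * t = ellMod L) (j : ℤ) :
    HasSum (fun w : {w : List (ℤ × ℤ) // IsExcursion w ∧ windExc w = π / 2 * j} =>
      t ^ (w.val.length - 1))
      (4 / thetaThree L ^ 2 * excSeries (Real.exp (-L)) j.natAbs) := by
  have h3 := thetaThree_pos hL
  have h2 := thetaTwo_pos hL
  have htR : 4 * t * thetaThree L ^ 2 = thetaTwo L ^ 2 := by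
    rw [ht, ellMod]
    field_simp
  have htC : 4 * (t : ℂ) * thetaInt L 0 ^ 2 = thetaHalf L 0 ^ 2 := by
    rw [← ofReal_thetaThree, ← ofReal_thetaTwo]
    exact_mod_cast htR
  have h := hasSum_excursions hL ht0 ht1 htC j
  have e : walkMean L j 1 1 = walkMean L (j.natAbs : ℤ) 1 1 := by
    rcases Int.natAbs_eq j with hj | hj
    · rw [← hj]
    · conv_lhs => rw [hj, walkMean_neg hL]
  have e2 : (walkMean L j 1 1).re =
      4 / thetaTwo L ^ 2 * excSeries (Real.exp (-L)) j.natAbs := by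
    rw [e, walkMean_eq_excSeries hL ht0 ht1 htC, ← ofReal_thetaTwo]
    exact_mod_cast ofReal_re _
  rw [e2] at h
  have e3 : 4 * t * (4 / thetaTwo L ^ 2 * excSeries (Real.exp (-L)) j.natAbs) =
      4 / thetaThree L ^ 2 * excSeries (Real.exp (-L)) j.natAbs := by
    rw [← htR]
    field_simp
  rwa [e3] at h

/-- Proposition 12, first part: for `t ∈ (0,1/4)`, `k = 4t`, and `α ∈ (π/2)ℤ`, the sum
defining `F^{(α)}(t)` converges and
`F^{(α)}(t) = (2π/K(k)) Σ_{n≥1} ((1-qⁿ)²/(1-q^{4n})) q^{n(2|α|/π+1)}`. -/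
theorem statement9 (t : ℝ) (ht : t ∈ Set.Ioo (0 : ℝ) (1 / 4)) (k : ℝ) (hk : k = 4 * t)
    (ja : ℤ) (α : ℝ) (hα : α = π / 2 * ja) :
    Summable (fun w : {w : List (ℤ × ℤ) // IsExcursion w ∧ windExc w = α} =>
        t ^ (w.val.length - 1)) ∧
    Fgen t α = 2 * π / Kell k *
      ∑' n : ℕ, (1 - qNome k ^ (n + 1)) ^ 2 / (1 - qNome k ^ (4 * (n + 1))) *
        qNome k ^ (((n : ℝ) + 1) * (2 * |α| / π + 1)) := by
  obtain ⟨ht0, ht1⟩ := ht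
  obtain ⟨L, hL, hLk⟩ := exists_ellMod_eq (k := k) (by linarith) (by linarith)
  subst hα
  have h := hasSum_excursions_excSeries hL ht0 ht1 (by rw [hLk, hk]) ja
  refine ⟨h.summable, ?_⟩
  have h3 := thetaThree_pos hL
  have hπ := Real.pi_pos
  rw [Fgen, h.tsum_eq, ← hLk, qNome_ellMod hL, Kell_ellMod hL, excSeries]
  congr 1
  · field_simp
    norm_num
  · refine tsum_congr fun n => ?_
    congr 1
    rw [← Real.rpow_natCast]
    congr 1
    rw [abs_mul, abs_of_pos (by positivity)]
    push_cast [Nat.cast_natAbs]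
    field_simp

end
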